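/- Fix t ∈ (0,1/4) and set k = 4t. For every integer n ≠ 0: Σ_{w ∈ ℒ_n^{even}} t^{|w|}/|w| = (1/|n|)·q_k^{4|n|}/(1−q_k^{4|n|}) and Σ_{w ∈ ℒ_n^{odd}} t^{|w|}/|w| = (1/|n|)·q_k^{2|n|}/(1−q_k^{4|n|}), both sums converging absolutely. -/

import Mathlib

open Complex Real Set

noncomputable section

/-- A lattice point `(x,y)` viewed as the complex number `x + iy`. -/
def ptC (p : ℤ × ℤ) : ℂ := (p.1 : ℂ) + (p.2 : ℂ) * Complex.I

/-- A diagonal step on `ℤ²`. -/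
def IsDiagStep (a b : ℤ × ℤ) : Prop :=
  b - a = (1, 1) ∨ b - a = (1, -1) ∨ b - a = (-1, -1) ∨ b - a = (-1, 1)

/-- A rectilinear step on `ℤ²`. -/
def IsRectStep (a b : ℤ × ℤ) : Prop :=
  b - a = (1, 0) ∨ b - a = (-1, 0) ∨ b - a = (0, 1) ∨ b - a = (0, -1)

/-- `w` encodes a simple diagonal walk `(w₀, …, w_n)` as a list of length `n+1`. -/
def IsWalkList (w : List (ℤ × ℤ)) : Prop := w ≠ [] ∧ w.Chain' IsDiagStep

/-- Winding angle of the walk `w` around the origin up to time `i`. -/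
def windTo (w : List (ℤ × ℤ)) (i : ℕ) : ℝ :=
  ∑ j ∈ Finset.range i, (ptC (w.getD (j + 1) 0) / ptC (w.getD j 0)).arg

/-- The full winding angle of the walk `w` around the origin. -/
def wind (w : List (ℤ × ℤ)) : ℝ := windTo w (w.length - 1)

/-- The condition on walks counted by `W^{(α,I)}_{l,p}`: a simple diagonal walk on
`ℤ² ∖ {0}` from `(p,0)` to a point on one of the axes at distance `l` from the origin,
with full winding angle `α` and intermediate winding angles in `I`. -/
def WCond (l p : ℕ) (α : ℝ) (I : Set ℝ) (w : List (ℤ × ℤ)) : Prop :=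
  IsWalkList w ∧ (∀ x ∈ w, x ≠ (0, 0)) ∧ w.head? = some ((p : ℤ), 0) ∧
    (w.getLast? = some ((l : ℤ), 0) ∨ w.getLast? = some (-(l : ℤ), 0) ∨
      w.getLast? = some (0, (l : ℤ)) ∨ w.getLast? = some (0, -(l : ℤ))) ∧
    wind w = α ∧ (∀ i, 1 ≤ i → i ≤ w.length - 2 → windTo w i ∈ I)

/-- The generating function `W^{(α,I)}_{l,p}(t)`. -/
def Wgen (t : ℝ) (l p : ℕ) (α : ℝ) (I : Set ℝ) : ℝ :=
  ∑' w : {w : List (ℤ × ℤ) // WCond l p α I w}, t ^ (w.val.length - 1)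

/-- The complete elliptic integral of the first kind `K(k)`. -/
def Kell (k : ℝ) : ℝ := ∫ y in (0:ℝ)..1, 1 / Real.sqrt ((1 - y ^ 2) * (1 - k ^ 2 * y ^ 2))

/-- The complete elliptic integral of the second kind `E(k)`. -/
def Eell (k : ℝ) : ℝ := ∫ y in (0:ℝ)..1, Real.sqrt (1 - k ^ 2 * y ^ 2) / Real.sqrt (1 - y ^ 2)

/-- The complementary modulus `k' = √(1-k²)`. -/
def kComp (k : ℝ) : ℝ := Real.sqrt (1 - k ^ 2)

/-- The elliptic nome `q_k = exp(-π K(k')/K(k))`. -/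
def qNome (k : ℝ) : ℝ := Real.exp (-π * Kell (kComp k) / Kell k)

/-- The descending Landen transformation `k₁ = (1-k')/(1+k')`. -/
def kLanden (k : ℝ) : ℝ := (1 - kComp k) / (1 + kComp k)

/-- `T_k = K(k')/(4K(k))`. -/
def Tell (k : ℝ) : ℝ := Kell (kComp k) / (4 * Kell k)

/-- The plane minus the two real slits `{z ∈ ℝ : z² ≥ κ}`. -/
def slitDom (κ : ℝ) : Set ℂ := {z : ℂ | ¬(z.im = 0 ∧ κ ≤ z.re ^ 2)}

/-- `v` is the analytic function `v_κ` on `ℂ ∖ {z ∈ ℝ : z² ≥ κ}` with `v 0 = 0` and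
`v'(z) = 1/(4K(κ)√((κ-z²)(1-κz²)))`, the branch of the square root being positive on
`(-√κ, √κ)` (by analytic continuation this determines `v` uniquely). -/
structure IsVmap (κ : ℝ) (v : ℂ → ℂ) : Prop where
  map_zero : v 0 = 0
  analytic : AnalyticOnNhd ℂ v (slitDom κ)
  deriv_real : ∀ x : ℝ, x ^ 2 < κ →
    HasDerivAt v ((1 / (4 * Kell κ * Real.sqrt ((κ - x ^ 2) * (1 - κ * x ^ 2))) : ℝ) : ℂ)
      (x : ℂ)

/-- The function `f_m(z) = cos(2πm(v(z) + 1/4)) - cos(πm/2)` built from `v = v_{k₁}`. -/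
def fmFun (v : ℂ → ℂ) (m : ℕ) (z : ℂ) : ℂ :=
  Complex.cos (2 * (π : ℂ) * m * (v z + 1 / 4)) - Complex.cos ((π : ℂ) * m / 2)

/-- `a n m` is the (real) Taylor coefficient `[zⁿ] f_m(z)` at `0`. -/
def IsCoeff (κ : ℝ) (v : ℂ → ℂ) (a : ℕ → ℕ → ℝ) : Prop :=
  ∀ m : ℕ, 1 ≤ m → ∀ z : ℂ, z ∈ slitDom κ → ‖z‖ < 1 →
    HasSum (fun n : ℕ => (a n m : ℂ) * z ^ n) (fmFun v m z)

/-- An excursion: a nonempty simple diagonal walk from the origin to the origin with no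
intermediate visits to the origin. -/
def IsExcursion (w : List (ℤ × ℤ)) : Prop :=
  2 ≤ w.length ∧ w.Chain' IsDiagStep ∧ w.head? = some (0, 0) ∧ w.getLast? = some (0, 0) ∧
    ∀ i, 1 ≤ i → i ≤ w.length - 2 → w.getD i 0 ≠ (0, 0)

/-- The winding angle sequence of an excursion: `θ₀ = θ₁ = 0`, increments of the first and
last step do not contribute, and `θ_n = θ_{n-1}`. -/
def windExcTo (w : List (ℤ × ℤ)) (i : ℕ) : ℝ :=
  ∑ j ∈ Finset.Icc 2 (min i (w.length - 2)), (ptC (w.getD j 0) / ptC (w.getD (j - 1) 0)).arg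

/-- The full winding angle of an excursion. -/
def windExc (w : List (ℤ × ℤ)) : ℝ := windExcTo w (w.length - 1)

/-- `F^{(α)}(t)`: generating function of excursions with winding angle `α`. -/
def Fgen (t α : ℝ) : ℝ :=
  ∑' w : {w : List (ℤ × ℤ) // IsExcursion w ∧ windExc w = α}, t ^ (w.val.length - 1)

/-- `F(t,b) = Σ_w t^{|w|} e^{i b θ^w}`, the characteristic function of excursions. -/
def Fchar (t b : ℝ) : ℂ :=
  ∑' w : {w : List (ℤ × ℤ) // IsExcursion w},
    (t : ℂ) ^ (w.val.length - 1) * Complex.exp (Complex.I * b * windExc w.val)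

/-- `ψ_k(z) = (1 - √(1-kz²))/(√k z)` (principal square root), `ψ_k(0) = 0`. -/
def psiK (k : ℝ) (z : ℂ) : ℂ :=
  if z = 0 then 0 else (1 - (1 - (k : ℂ) * z ^ 2) ^ ((1 : ℂ) / 2)) / ((Real.sqrt k : ℂ) * z)

/-- A rooted loop of index `n`: a simple diagonal walk on `ℤ² ∖ {0}` starting and ending
at the same point, with full winding angle `2πn`. -/
def IsLoop (n : ℤ) (w : List (ℤ × ℤ)) : Prop :=
  IsWalkList w ∧ (∀ x ∈ w, x ≠ (0, 0)) ∧ w.head? = w.getLast? ∧ wind w = 2 * π * n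

/-- The `p`-th Fourier coefficient of `A(θ) exp(i ψ(θ))`, real when `A` is even and `ψ` is odd. -/
def realFourier (A ψ : ℝ → ℝ) (p : ℤ) : ℝ :=
  1 / (2 * π) * ∫ θ in -π..π, A θ * Real.cos (ψ θ - p * θ)

lemma neg_pi_lt_pi : -π < π := by linarith [Real.pi_pos]

lemma integral_odd_symm {f : ℝ → ℝ} (hf : ∀ x, f (-x) = -f x) (a : ℝ) :
    ∫ x in -a..a, f x = 0 := by
  have h := intervalIntegral.integral_comp_neg (a := -a) (b := a) f
  simp only [hf, intervalIntegral.integral_neg, neg_neg] at h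
  linarith

lemma fourierCoeffOn_eq_realFourier {A ψ : ℝ → ℝ} (hA : Continuous A) (hψ : Continuous ψ)
    (hAe : ∀ x, A (-x) = A x) (hψo : ∀ x, ψ (-x) = -ψ x) (p : ℤ) :
    fourierCoeffOn neg_pi_lt_pi (fun θ => (A θ : ℂ) * cexp (I * ψ θ)) p =
      (realFourier A ψ p : ℂ) := by
  rw [fourierCoeffOn_eq_integral]
  have h1 : ∀ θ : ℝ, fourier (-p) (θ : AddCircle (π - -π)) • ((A θ : ℂ) * cexp (I * ψ θ)) =
      ((A θ * Real.cos (ψ θ - p * θ) : ℝ) : ℂ) + I * ((A θ * Real.sin (ψ θ - p * θ) : ℝ) : ℂ) := by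
    intro θ
    rw [fourier_coe_apply, smul_eq_mul]
    have e1 : 2 * (π : ℂ) * I * ((-p : ℤ) : ℂ) * θ / ((π - -π : ℝ) : ℂ) = -(I * (p * θ)) := by
      have : (π : ℂ) ≠ 0 := by exact_mod_cast Real.pi_ne_zero
      push_cast
      field_simp
      ring
    rw [e1, mul_left_comm, ← Complex.exp_add]
    have e2 : -(I * ((p : ℂ) * θ)) + I * ψ θ = ((ψ θ - p * θ : ℝ) : ℂ) * I := by
      push_cast; ring
    rw [e2, Complex.exp_mul_I]
    push_cast
    ring
  simp_rw [h1]
  rw [intervalIntegral.integral_add, intervalIntegral.integral_const_mul,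
    intervalIntegral.integral_ofReal, intervalIntegral.integral_ofReal,
    integral_odd_symm (f := fun θ => A θ * Real.sin (ψ θ - p * θ))]
  · rw [realFourier, Complex.real_smul]
    push_cast
    simp only [mul_zero, add_zero]
    congr 1
    ring
  · intro x
    have : -ψ x - p * -x = -(ψ x - p * x) := by ring
    rw [hAe, hψo, this, Real.sin_neg, mul_neg]
  · exact Continuous.intervalIntegrable (by fun_prop) _ _
  · exact Continuous.intervalIntegrable (by fun_prop) _ _

lemma fourierCoeffOn_add_sub {f g : ℝ → ℂ} (hf : Continuous f) (hg : Continuous g) (p : ℤ) :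
    fourierCoeffOn neg_pi_lt_pi (fun θ => f θ + g θ) p =
      fourierCoeffOn neg_pi_lt_pi f p + fourierCoeffOn neg_pi_lt_pi g p ∧
    fourierCoeffOn neg_pi_lt_pi (fun θ => f θ - g θ) p =
      fourierCoeffOn neg_pi_lt_pi f p - fourierCoeffOn neg_pi_lt_pi g p := by
  have hF : Continuous fun x : ℝ => fourier (-p) (x : AddCircle (π - -π)) :=
    (map_continuous (fourier (-p))).comp (AddCircle.continuous_mk' _)
  simp only [fourierCoeffOn_eq_integral, smul_add, smul_sub]
  constructor
  · rw [intervalIntegral.integral_add]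
    · simp
    · exact (hF.smul hf).intervalIntegrable _ _
    · exact (hF.smul hg).intervalIntegrable _ _
  · rw [intervalIntegral.integral_sub]
    · simp [mul_sub]
    · exact (hF.smul hf).intervalIntegrable _ _
    · exact (hF.smul hg).intervalIntegrable _ _

lemma hasSum_sq_fourierCoeffOn_of_continuous {f : ℝ → ℂ} (hf : Continuous f) :
    HasSum (fun p => ‖fourierCoeffOn neg_pi_lt_pi f p‖ ^ 2)
      (1 / (2 * π) * ∫ x in -π..π, ‖f x‖ ^ 2) := by
  have h := hasSum_sq_fourierCoeffOn (f := f) neg_pi_lt_pi (by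
    obtain ⟨C, hC⟩ := isCompact_Icc.exists_bound_of_continuousOn (s := Icc (-π) π) hf.continuousOn
    refine MeasureTheory.MemLp.of_bound hf.aestronglyMeasurable C ?_
    filter_upwards [MeasureTheory.ae_restrict_mem measurableSet_Ioc] with x hx
    exact hC x (Ioc_subset_Icc_self hx))
  convert h using 1
  rw [smul_eq_mul]
  congr 1
  rw [one_div]; congr 1; ring

/-- Parseval's identity for two functions with real Fourier coefficients. -/
lemma hasSum_realFourier_mul {A₁ A₂ ψ₁ ψ₂ : ℝ → ℝ} (hA₁ : Continuous A₁) (hA₂ : Continuous A₂)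
    (hψ₁ : Continuous ψ₁) (hψ₂ : Continuous ψ₂) (hA₁e : ∀ x, A₁ (-x) = A₁ x)
    (hA₂e : ∀ x, A₂ (-x) = A₂ x) (hψ₁o : ∀ x, ψ₁ (-x) = -ψ₁ x) (hψ₂o : ∀ x, ψ₂ (-x) = -ψ₂ x) :
    HasSum (fun p => realFourier A₁ ψ₁ p * realFourier A₂ ψ₂ p)
      (1 / (2 * π) * ∫ θ in -π..π, A₁ θ * A₂ θ * Real.cos (ψ₁ θ - ψ₂ θ)) := by
  set f : ℝ → ℂ := fun θ => (A₁ θ : ℂ) * cexp (I * ψ₁ θ) with hf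
  set g : ℝ → ℂ := fun θ => (A₂ θ : ℂ) * cexp (I * ψ₂ θ) with hg
  have hfc : Continuous f := by fun_prop
  have hgc : Continuous g := by fun_prop
  have hs := hasSum_sq_fourierCoeffOn_of_continuous (f := fun θ => f θ + g θ) (hfc.add hgc)
  have hd := hasSum_sq_fourierCoeffOn_of_continuous (f := fun θ => f θ - g θ) (hfc.sub hgc)
  have key := (hs.sub hd).mul_left (1 / 4)
  have e : ∀ {u v : ℤ → ℝ} {a b : ℝ}, u = v → a = b → HasSum v b → HasSum u a := by
    rintro u v a b rfl rfl h; exact h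
  refine e ?_ ?_ key
  · funext p
    have h1 := (fourierCoeffOn_add_sub hfc hgc p).1
    have h2 := (fourierCoeffOn_add_sub hfc hgc p).2
    rw [hf, hg, fourierCoeffOn_eq_realFourier hA₁ hψ₁ hA₁e hψ₁o,
      fourierCoeffOn_eq_realFourier hA₂ hψ₂ hA₂e hψ₂o] at h1 h2
    rw [h1, h2, ← Complex.ofReal_add, ← Complex.ofReal_sub, Complex.norm_real, Complex.norm_real,
      Real.norm_eq_abs, Real.norm_eq_abs, sq_abs, sq_abs]
    ring
  · rw [← mul_sub, ← intervalIntegral.integral_sub, mul_left_comm]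
    · congr 1
      rw [← intervalIntegral.integral_const_mul]
      refine intervalIntegral.integral_congr fun θ _ => ?_
      have e : ∀ z : ℂ, ‖z‖ ^ 2 = z.re ^ 2 + z.im ^ 2 := fun z => by
        rw [← Complex.normSq_eq_norm_sq, Complex.normSq_apply]; ring
      have e3 : ∀ x : ℝ, cexp (I * x) = Real.cos x + Real.sin x * I := fun x => by
        rw [mul_comm, Complex.exp_mul_I, Complex.ofReal_cos, Complex.ofReal_sin]
      simp only [e, hf, hg, e3, Real.cos_sub]
      simp [-Complex.ofReal_cos, -Complex.ofReal_sin]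
      ring
    · exact Continuous.intervalIntegrable (by fun_prop) _ _
    · exact Continuous.intervalIntegrable (by fun_prop) _ _

/-- Pointwise convergence at `0` of the Fourier series when the coefficients are summable. -/
lemma hasSum_realFourier_zero {A ψ : ℝ → ℝ} (hA : Continuous A) (hψ : Continuous ψ)
    (hAe : ∀ x, A (-x) = A x) (hψo : ∀ x, ψ (-x) = -ψ x)
    (hp : ∀ x, (A (x + 2 * π) : ℂ) * cexp (I * ψ (x + 2 * π)) = A x * cexp (I * ψ x))
    (hs : Summable (realFourier A ψ)) : HasSum (realFourier A ψ) (A 0) := by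
  have hT : Fact (0 < 2 * π) := ⟨Real.two_pi_pos⟩
  set f : ℝ → ℂ := fun θ => (A θ : ℂ) * cexp (I * ψ θ) with hf
  have hfp : Function.Periodic f (2 * π) := hp
  have hfc : Continuous f := by fun_prop
  let F : C(AddCircle (2 * π), ℂ) := ⟨hfp.lift, hfc.quotient_lift _⟩
  have hcoef : ∀ p, fourierCoeff F p = (realFourier A ψ p : ℂ) := by
    intro p
    rw [← fourierCoeffOn_eq_realFourier hA hψ hAe hψo, fourierCoeffOn_eq_integral,
      fourierCoeff_eq_intervalIntegral _ _ (-π)]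
    have h2 : π - -π = 2 * π := by ring
    have h3 : -π + 2 * π = π := by ring
    rw [h3, h2]
    rfl
  have h := has_pointwise_sum_fourier_series_of_summable (f := F) (by
    have : fourierCoeff F = fun p => (realFourier A ψ p : ℂ) := funext hcoef
    rw [this]; exact_mod_cast hs) (0 : ℝ)
  have h0 : F ((0 : ℝ) : AddCircle (2 * π)) = ((A 0 : ℝ) : ℂ) := by
    have : ψ 0 = 0 := by have := hψo 0; simp at this; linarith
    change f 0 = _
    simp [hf, this]
  rw [h0] at h
  have h4 : ∀ p, fourierCoeff F p • fourier p ((0 : ℝ) : AddCircle (2 * π)) =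
      (realFourier A ψ p : ℂ) := by
    intro p; rw [hcoef, fourier_coe_apply]; simp
  simp only [h4] at h
  exact_mod_cast h

lemma Kell_eq_integral_sin (k : ℝ) :
    Kell k = ∫ ψ in (0 : ℝ)..π / 2, 1 / Real.sqrt (1 - k ^ 2 * Real.sin ψ ^ 2) := by
  have hpi : (0 : ℝ) ≤ π / 2 := by positivity
  rw [Kell, intervalIntegral.integral_of_le zero_le_one, intervalIntegral.integral_of_le hpi,
    MeasureTheory.integral_Ioc_eq_integral_Ioo, MeasureTheory.integral_Ioc_eq_integral_Ioo]
  have himg : Real.sin '' Ioo 0 (π / 2) = Ioo 0 1 := by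
    ext y
    constructor
    · rintro ⟨x, ⟨hx0, hx1⟩, rfl⟩
      refine ⟨Real.sin_pos_of_pos_of_lt_pi hx0 (by linarith), ?_⟩
      rw [← Real.sin_pi_div_two]
      exact Real.sin_lt_sin_of_lt_of_le_pi_div_two (by linarith) le_rfl hx1
    · rintro ⟨h0, h1⟩
      exact ⟨Real.arcsin y, ⟨Real.arcsin_pos.2 h0, Real.arcsin_lt_pi_div_two.2 h1⟩,
        Real.sin_arcsin (by linarith) h1.le⟩
  have hinj : InjOn Real.sin (Ioo 0 (π / 2)) :=
    Real.injOn_sin.mono (Ioo_subset_Icc_self.trans (Icc_subset_Icc (by linarith) le_rfl))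
  rw [← himg, MeasureTheory.integral_image_eq_integral_abs_deriv_smul measurableSet_Ioo
    (fun x _ => (Real.hasDerivAt_sin x).hasDerivWithinAt) hinj]
  refine MeasureTheory.setIntegral_congr_fun measurableSet_Ioo fun x hx => ?_
  have hc : 0 < Real.cos x := Real.cos_pos_of_mem_Ioo ⟨by linarith [hx.1], hx.2⟩
  have h1 : 1 - Real.sin x ^ 2 = Real.cos x ^ 2 := by rw [Real.cos_sq']
  simp only [h1]
  rw [Real.sqrt_mul (sq_nonneg _), Real.sqrt_sq hc.le, abs_of_pos hc, smul_eq_mul]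
  field_simp

/-- The delta amplitude `√(1 - k² cos² θ)`. -/
def deltaAmp (k θ : ℝ) : ℝ := Real.sqrt (1 - k ^ 2 * Real.cos θ ^ 2)

/-- The constant `π / (2 K(k))`. -/
def ellC (k : ℝ) : ℝ := π / (2 * Kell k)

/-- The normalised elliptic integral of the first kind. -/
def ellX (k θ : ℝ) : ℝ := ∫ s in (0 : ℝ)..θ, ellC k / deltaAmp k s

/-- The decay factor in the vertical direction of the separated harmonic functions. -/
def ellT (k θ : ℝ) : ℝ := k * Real.cos θ / (1 + deltaAmp k θ)


lemma deltaAmp_arg_pos {k : ℝ} (hk : k ∈ Ioo (0 : ℝ) 1) (θ : ℝ) :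
    0 < 1 - k ^ 2 * Real.cos θ ^ 2 := by
  have h1 : k ^ 2 < 1 := by nlinarith [hk.1, hk.2]
  nlinarith [Real.cos_sq_le_one θ, sq_nonneg (Real.cos θ)]

lemma deltaAmp_pos {k : ℝ} (hk : k ∈ Ioo (0 : ℝ) 1) (θ : ℝ) : 0 < deltaAmp k θ :=
  Real.sqrt_pos.2 (deltaAmp_arg_pos hk θ)

lemma deltaAmp_sq {k : ℝ} (hk : k ∈ Ioo (0 : ℝ) 1) (θ : ℝ) :
    deltaAmp k θ ^ 2 = 1 - k ^ 2 * Real.cos θ ^ 2 :=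
  Real.sq_sqrt (deltaAmp_arg_pos hk θ).le

lemma deltaAmp_neg (k θ : ℝ) : deltaAmp k (-θ) = deltaAmp k θ := by
  simp [deltaAmp]

lemma deltaAmp_add_pi (k θ : ℝ) : deltaAmp k (θ + π) = deltaAmp k θ := by
  simp [deltaAmp]

lemma contDiff_deltaAmp {k : ℝ} (hk : k ∈ Ioo (0 : ℝ) 1) (n : ℕ) :
    ContDiff ℝ n (deltaAmp k) := by
  refine ContDiff.sqrt ?_ fun θ => (deltaAmp_arg_pos hk θ).ne'
  exact contDiff_const.sub (contDiff_const.mul (Real.contDiff_cos.pow 2))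

lemma continuous_deltaAmp (k : ℝ) : Continuous (deltaAmp k) := by
  unfold deltaAmp; fun_prop

lemma hasDerivAt_deltaAmp {k : ℝ} (hk : k ∈ Ioo (0 : ℝ) 1) (θ : ℝ) :
    HasDerivAt (deltaAmp k) (k ^ 2 * Real.cos θ * Real.sin θ / deltaAmp k θ) θ := by
  have h := (((Real.hasDerivAt_cos θ).pow 2).const_mul (k ^ 2)).const_sub 1
  have h2 := h.sqrt (deltaAmp_arg_pos hk θ).ne'
  have := deltaAmp_pos hk θ
  refine h2.congr_deriv ?_
  change _ / (2 * deltaAmp k θ) = _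
  field_simp
  ring

lemma continuous_inv_deltaAmp {k : ℝ} (hk : k ∈ Ioo (0 : ℝ) 1) (c : ℝ) :
    Continuous fun θ => c / deltaAmp k θ :=
  continuous_const.div (continuous_deltaAmp k) fun θ => (deltaAmp_pos hk θ).ne'

lemma integral_inv_deltaAmp {k : ℝ} (hk : k ∈ Ioo (0 : ℝ) 1) :
    ∫ θ in (0 : ℝ)..π, 1 / deltaAmp k θ = 2 * Kell k := by
  have hc := continuous_inv_deltaAmp hk 1
  rw [← intervalIntegral.integral_add_adjacent_intervals (hc.intervalIntegrable 0 (π / 2))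
    (hc.intervalIntegrable (π / 2) π), two_mul, Kell_eq_integral_sin]
  congr 1
  · have h := intervalIntegral.integral_comp_sub_left (a := 0) (b := π / 2)
      (fun θ => 1 / deltaAmp k θ) (π / 2)
    simp only [sub_zero, sub_self] at h
    rw [← h]
    simp [deltaAmp, Real.cos_pi_div_two_sub]
  · have h := intervalIntegral.integral_comp_add_right (a := 0) (b := π / 2)
      (fun θ => 1 / deltaAmp k θ) (π / 2)
    simp only [zero_add, add_halves] at h
    rw [← h]
    simp [deltaAmp, Real.cos_add_pi_div_two]

lemma Kell_pos {k : ℝ} (hk : k ∈ Ioo (0 : ℝ) 1) : 0 < Kell k := by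
  have h : 0 < ∫ θ in (0 : ℝ)..π, 1 / deltaAmp k θ :=
    intervalIntegral.intervalIntegral_pos_of_pos
      ((continuous_inv_deltaAmp hk 1).intervalIntegrable _ _)
      (fun θ => div_pos one_pos (deltaAmp_pos hk θ)) Real.pi_pos
  rw [integral_inv_deltaAmp hk] at h
  linarith

lemma ellC_pos {k : ℝ} (hk : k ∈ Ioo (0 : ℝ) 1) : 0 < ellC k :=
  div_pos Real.pi_pos (mul_pos two_pos (Kell_pos hk))

lemma hasDerivAt_ellX {k : ℝ} (hk : k ∈ Ioo (0 : ℝ) 1) (θ : ℝ) :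
    HasDerivAt (ellX k) (ellC k / deltaAmp k θ) θ :=
  (continuous_inv_deltaAmp hk (ellC k)).integral_hasStrictDerivAt 0 θ |>.hasDerivAt

lemma continuous_ellX {k : ℝ} (hk : k ∈ Ioo (0 : ℝ) 1) : Continuous (ellX k) :=
  continuous_iff_continuousAt.2 fun θ => (hasDerivAt_ellX hk θ).continuousAt

lemma ellX_zero (k : ℝ) : ellX k 0 = 0 := by simp [ellX]

lemma ellX_neg (k θ : ℝ) : ellX k (-θ) = -ellX k θ := by
  have h := intervalIntegral.integral_comp_neg (a := 0) (b := θ) (fun s => ellC k / deltaAmp k s)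
  simp only [deltaAmp_neg, neg_zero] at h
  rw [ellX, ellX, h, intervalIntegral.integral_symm]

lemma ellX_add_pi {k : ℝ} (hk : k ∈ Ioo (0 : ℝ) 1) (θ : ℝ) : ellX k (θ + π) = ellX k θ + π := by
  have hc := continuous_inv_deltaAmp hk (ellC k)
  have hper : Function.Periodic (fun s => ellC k / deltaAmp k s) π := fun s => by
    simp only [deltaAmp_add_pi]
  rw [ellX, ← intervalIntegral.integral_add_adjacent_intervals (hc.intervalIntegrable 0 θ)
    (hc.intervalIntegrable θ (θ + π)), hper.intervalIntegral_add_eq θ 0, zero_add, ellX]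
  congr 1
  have : ∀ s, ellC k / deltaAmp k s = ellC k * (1 / deltaAmp k s) := fun s => by ring
  simp only [this]
  rw [intervalIntegral.integral_const_mul, integral_inv_deltaAmp hk, ellC]
  have := Kell_pos hk
  field_simp

lemma ellX_add_two_pi {k : ℝ} (hk : k ∈ Ioo (0 : ℝ) 1) (θ : ℝ) :
    ellX k (θ + 2 * π) = ellX k θ + 2 * π := by
  rw [show θ + 2 * π = θ + π + π by ring, ellX_add_pi hk, ellX_add_pi hk]; ring

lemma ellX_pi {k : ℝ} (hk : k ∈ Ioo (0 : ℝ) 1) : ellX k π = π := by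
  simpa [ellX_zero] using ellX_add_pi hk 0

lemma contDiff_ellX {k : ℝ} (hk : k ∈ Ioo (0 : ℝ) 1) (n : ℕ) :
    ContDiff ℝ (n + 1 : ℕ) (ellX k) := by
  have hd : deriv (ellX k) = fun θ => ellC k / deltaAmp k θ :=
    funext fun θ => (hasDerivAt_ellX hk θ).deriv
  have : ContDiff ℝ ((n : ℕ) + 1) (ellX k) := by
    refine contDiff_succ_iff_deriv.2 ⟨fun θ => (hasDerivAt_ellX hk θ).differentiableAt, ?_, ?_⟩
    · simp
    · rw [hd]
      exact contDiff_const.div (contDiff_deltaAmp hk n) fun θ => (deltaAmp_pos hk θ).ne'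
  exact_mod_cast this

lemma strictMono_ellX {k : ℝ} (hk : k ∈ Ioo (0 : ℝ) 1) : StrictMono (ellX k) :=
  strictMono_of_deriv_pos fun θ => by
    rw [(hasDerivAt_ellX hk θ).deriv]; exact div_pos (ellC_pos hk) (deltaAmp_pos hk θ)

lemma surjective_ellX {k : ℝ} (hk : k ∈ Ioo (0 : ℝ) 1) : Function.Surjective (ellX k) := by
  intro y
  have hn : ∀ n : ℕ, ellX k (n * π) = n * π := by
    intro n
    induction n with
    | zero => simp [ellX_zero]
    | succ n ih => push_cast; rw [add_mul, one_mul, ellX_add_pi hk, ih]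
  obtain ⟨n, hn'⟩ := exists_nat_ge (|y| / π)
  have h1 : |y| ≤ n * π := (div_le_iff₀ Real.pi_pos).1 hn'
  have h2 := intermediate_value_Icc (a := -(n * π)) (b := n * π)
    (by linarith [abs_nonneg y]) (continuous_ellX hk).continuousOn
  rw [ellX_neg, hn] at h2
  obtain ⟨x, -, hx⟩ := h2 (abs_le.1 h1)
  exact ⟨x, hx⟩

/-- The inverse function of `ellX k`. -/
def ellXInv {k : ℝ} (hk : k ∈ Ioo (0 : ℝ) 1) : ℝ ≃o ℝ :=
  (StrictMono.orderIsoOfSurjective _ (strictMono_ellX hk) (surjective_ellX hk)).symm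

lemma ellXInv_ellX {k : ℝ} (hk : k ∈ Ioo (0 : ℝ) 1) (θ : ℝ) : ellXInv hk (ellX k θ) = θ :=
  OrderIso.symm_apply_apply (StrictMono.orderIsoOfSurjective _ (strictMono_ellX hk)
    (surjective_ellX hk)) θ

lemma ellX_ellXInv {k : ℝ} (hk : k ∈ Ioo (0 : ℝ) 1) (θ : ℝ) : ellX k (ellXInv hk θ) = θ :=
  OrderIso.apply_symm_apply (StrictMono.orderIsoOfSurjective _ (strictMono_ellX hk)
    (surjective_ellX hk)) θ

lemma ellXInv_neg {k : ℝ} (hk : k ∈ Ioo (0 : ℝ) 1) (θ : ℝ) :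
    ellXInv hk (-θ) = -ellXInv hk θ := by
  apply (strictMono_ellX hk).injective
  rw [ellX_neg, ellX_ellXInv, ellX_ellXInv]

lemma one_add_deltaAmp_pos {k : ℝ} (θ : ℝ) : 0 < 1 + deltaAmp k θ := by
  have : 0 ≤ deltaAmp k θ := Real.sqrt_nonneg _
  linarith

lemma continuous_ellT {k : ℝ} : Continuous (ellT k) := by
  refine Continuous.div (by fun_prop) (continuous_const.add (continuous_deltaAmp k)) ?_
  exact fun θ => (one_add_deltaAmp_pos θ).ne'

lemma ellT_neg (k θ : ℝ) : ellT k (-θ) = ellT k θ := by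
  simp [ellT, deltaAmp_neg]

lemma ellT_quadratic {k : ℝ} (hk : k ∈ Ioo (0 : ℝ) 1) (θ : ℝ) :
    k / 2 * Real.cos θ * (ellT k θ ^ 2 + 1) = ellT k θ := by
  have h := one_add_deltaAmp_pos (k := k) θ
  have h2 := deltaAmp_sq hk θ
  unfold ellT
  field_simp
  linear_combination (k * Real.cos θ) * h2

lemma ellT_mul_cos {k : ℝ} (hk : k ∈ Ioo (0 : ℝ) 1) (θ : ℝ) :
    k / 2 * Real.cos θ * ellT k θ = (1 - deltaAmp k θ) / 2 := by
  have h := one_add_deltaAmp_pos (k := k) θ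
  have h2 := deltaAmp_sq hk θ
  unfold ellT
  field_simp
  linear_combination h2

lemma abs_ellT_le_one {k : ℝ} (hk : k ∈ Ioo (0 : ℝ) 1) (θ : ℝ) : |ellT k θ| ≤ 1 := by
  have h := one_add_deltaAmp_pos (k := k) θ
  rw [ellT, abs_div, abs_of_pos h, div_le_one h, abs_mul, abs_of_pos hk.1]
  have h1 := Real.abs_cos_le_one θ
  have : 0 ≤ deltaAmp k θ := Real.sqrt_nonneg _
  nlinarith [hk.1, hk.2, abs_nonneg (Real.cos θ)]

/-- Fourier coefficients of `exp(i m x(θ))`. -/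
def coefA (k : ℝ) (m p : ℤ) : ℝ := realFourier (fun _ => 1) (fun θ => m * ellX k θ) p

/-- Fourier coefficients of `exp(i m x(θ)) τ(θ)^Y x'(θ)`. -/
def coefB (k : ℝ) (m X : ℤ) (Y : ℕ) : ℝ :=
  realFourier (fun θ => ellT k θ ^ Y * (ellC k / deltaAmp k θ)) (fun θ => m * ellX k θ) X

lemma coefA_eq (k : ℝ) (m p : ℤ) :
    coefA k m p = 1 / (2 * π) * ∫ θ in -π..π, Real.cos (m * ellX k θ - p * θ) := by
  simp [coefA, realFourier]

lemma coefA_neg_neg (k : ℝ) (m p : ℤ) : coefA k (-m) (-p) = coefA k m p := by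
  simp only [coefA_eq]
  congr 2
  funext θ
  rw [← Real.cos_neg]
  push_cast
  ring_nf

lemma coefB_neg_neg (k : ℝ) (m p : ℤ) (Y : ℕ) : coefB k (-m) (-p) Y = coefB k m p Y := by
  simp only [coefB, realFourier]
  congr 2
  funext θ
  rw [← Real.cos_neg]
  push_cast
  ring_nf

lemma sin_boundary {k : ℝ} (hk : k ∈ Ioo (0 : ℝ) 1) (m p : ℤ) :
    Real.sin (m * ellX k π - p * π) = 0 := by
  rw [ellX_pi hk, ← sub_mul]
  exact_mod_cast Real.sin_int_mul_pi (m - p)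

lemma hasDerivAt_phase {k : ℝ} (hk : k ∈ Ioo (0 : ℝ) 1) (m p : ℤ) (θ : ℝ) :
    HasDerivAt (fun θ => m * ellX k θ - p * θ) (m * (ellC k / deltaAmp k θ) - p) θ :=
  (((hasDerivAt_ellX hk θ).const_mul (m : ℝ)).sub
    ((hasDerivAt_id θ).const_mul (p : ℝ))).congr_deriv (by simp)

lemma coefA_mul_eq {k : ℝ} (hk : k ∈ Ioo (0 : ℝ) 1) (m p : ℤ) :
    p * coefA k m p = m * coefB k m p 0 := by
  have hx := continuous_ellX hk
  have hi := continuous_inv_deltaAmp hk (ellC k)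
  have hd : ∀ θ ∈ uIcc (-π) π, HasDerivAt (fun θ => Real.sin (m * ellX k θ - p * θ))
      (m * ((ellC k / deltaAmp k θ) * Real.cos (m * ellX k θ - p * θ)) -
        p * Real.cos (m * ellX k θ - p * θ)) θ := fun θ _ =>
    ((Real.hasDerivAt_sin _).comp θ (hasDerivAt_phase hk m p θ)).congr_deriv (by ring)
  have h := intervalIntegral.integral_eq_sub_of_hasDerivAt hd
    (Continuous.intervalIntegrable (by fun_prop) _ _)
  have hb : Real.sin (m * ellX k (-π) - p * -π) = 0 := by
    rw [ellX_neg, show (m : ℝ) * -ellX k π - p * -π = -(m * ellX k π - p * π) by ring,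
      Real.sin_neg, sin_boundary hk, neg_zero]
  rw [sin_boundary hk, hb, intervalIntegral.integral_sub
    (Continuous.intervalIntegrable (by fun_prop) _ _)
    (Continuous.intervalIntegrable (by fun_prop) _ _), intervalIntegral.integral_const_mul,
    intervalIntegral.integral_const_mul] at h
  rw [coefA_eq, coefB, realFourier]
  simp only [pow_zero, one_mul]
  linear_combination (-1 / (2 * π)) * h

lemma coefA_eq_zero_of_odd {k : ℝ} (hk : k ∈ Ioo (0 : ℝ) 1) {m p : ℤ} (h : Odd (m - p)) :
    coefA k m p = 0 := by
  have hcos : ∀ (a : ℝ) (j : ℤ), Odd j → Real.cos (a + j * π) = -Real.cos a := by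
    rintro a j ⟨i, rfl⟩
    have : a + ((2 * i + 1 : ℤ) : ℝ) * π = a + π + i * (2 * π) := by push_cast; ring
    rw [this, Real.cos_add_int_mul_two_pi, Real.cos_add_pi]
  set F : ℝ → ℝ := fun θ => Real.cos (m * ellX k θ - p * θ) with hF
  have hanti : ∀ θ, F (θ + π) = -F θ := by
    intro θ
    rw [hF, ← hcos _ _ h]
    simp only [ellX_add_pi hk]
    push_cast
    ring_nf
  have hper : Function.Periodic F (2 * π) := fun θ => by
    rw [show θ + 2 * π = θ + π + π by ring, hanti, hanti, neg_neg]
  have h1 : ∫ θ in -π..π, F θ = ∫ θ in (0 : ℝ)..2 * π, F θ := by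
    have := hper.intervalIntegral_add_eq (-π) 0
    rwa [zero_add, show -π + 2 * π = π by ring] at this
  have h2 := intervalIntegral.integral_comp_add_right (a := -π) (b := π) F π
  simp only [hanti, intervalIntegral.integral_neg, neg_add_cancel, ← two_mul, ← h1] at h2
  rw [coefA_eq, show ∫ θ in -π..π, Real.cos (m * ellX k θ - p * θ) = 0 by linarith, mul_zero]

lemma coefA_recurrence {k : ℝ} (hk : k ∈ Ioo (0 : ℝ) 1) (m p : ℤ) :
    k ^ 2 / 4 * ((p - 2) * (p - 1) * coefA k m (p - 2) + (p + 2) * (p + 1) * coefA k m (p + 2)) +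
      (m ^ 2 * ellC k ^ 2 - (1 - k ^ 2 / 2) * p ^ 2) * coefA k m p = 0 := by
  have hx := continuous_ellX hk
  have hi := continuous_inv_deltaAmp hk (ellC k)
  have hsin := sin_boundary hk m p
  set f : ℝ → ℝ := fun θ => m * ellC k * deltaAmp k θ + p * deltaAmp k θ ^ 2
  set g : ℝ → ℝ := fun θ => k ^ 2 * (Real.cos θ * Real.sin θ)
  have hd : ∀ θ ∈ uIcc (-π) π, HasDerivAt (fun θ => Real.sin (m * ellX k θ - p * θ) * f θ +
      Real.cos (m * ellX k θ - p * θ) * g θ)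
      (k ^ 2 / 4 * (p - 2) * (p - 1) * Real.cos (m * ellX k θ - (p - 2) * θ) +
        k ^ 2 / 4 * (p + 2) * (p + 1) * Real.cos (m * ellX k θ - (p + 2) * θ) +
        (m ^ 2 * ellC k ^ 2 - (1 - k ^ 2 / 2) * p ^ 2) * Real.cos (m * ellX k θ - p * θ)) θ := by
    intro θ _
    have hα := hasDerivAt_phase hk m p θ
    have hw := hasDerivAt_deltaAmp hk θ
    have hf : HasDerivAt f _ θ := (hw.const_mul (m * ellC k)).add ((hw.pow 2).const_mul (p : ℝ))
    have hg : HasDerivAt g _ θ :=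
      ((Real.hasDerivAt_cos θ).mul (Real.hasDerivAt_sin θ)).const_mul (k ^ 2)
    have h := (((Real.hasDerivAt_sin _).comp θ hα).mul hf).add
      (((Real.hasDerivAt_cos _).comp θ hα).mul hg)
    refine h.congr_deriv ?_
    have hw0 := (deltaAmp_pos hk θ).ne'
    have hsq := deltaAmp_sq hk θ
    have e1 : m * ellX k θ - (p - 2) * θ = (m * ellX k θ - p * θ) + 2 * θ := by ring
    have e2 : m * ellX k θ - (p + 2) * θ = (m * ellX k θ - p * θ) - 2 * θ := by ring
    rw [e1, e2]
    have hsc := Real.sin_sq_add_cos_sq θ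
    simp only [f, g, Function.comp_apply]
    generalize m * ellX k θ - p * θ = α
    rw [Real.cos_add, Real.cos_sub, Real.cos_two_mul, Real.sin_two_mul]
    field_simp
    push_cast
    linear_combination (-8 * deltaAmp k θ * Real.cos α * p ^ 2) * hsq
      - (8 * k ^ 2 * deltaAmp k θ * Real.cos α) * hsc
  have h := intervalIntegral.integral_eq_sub_of_hasDerivAt hd
    (Continuous.intervalIntegrable (by fun_prop) _ _)
  have hb : Real.sin (m * ellX k (-π) - p * -π) = 0 := by
    rw [ellX_neg, show (m : ℝ) * -ellX k π - p * -π = -(m * ellX k π - p * π) by ring,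
      Real.sin_neg, sin_boundary hk, neg_zero]
  rw [sin_boundary hk, hb, intervalIntegral.integral_add
    (Continuous.intervalIntegrable (by fun_prop) _ _)
    (Continuous.intervalIntegrable (by fun_prop) _ _), intervalIntegral.integral_add
    (Continuous.intervalIntegrable (by fun_prop) _ _)
    (Continuous.intervalIntegrable (by fun_prop) _ _), intervalIntegral.integral_const_mul,
    intervalIntegral.integral_const_mul, intervalIntegral.integral_const_mul] at h
  simp only [g, Real.sin_pi, Real.sin_neg, mul_zero, neg_zero, zero_mul, add_zero, sub_zero] at h
  simp only [coefA_eq]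
  push_cast
  linear_combination (1 / (2 * π)) * h

lemma exists_pow_mul_fourierCoeffOn_le (n : ℕ) : ∀ f : ℝ → ℂ, ContDiff ℝ n f →
    (∀ x, f (x + 2 * π) = f x) →
    ∃ B, ∀ p : ℤ, |(p : ℝ)| ^ n * ‖fourierCoeffOn neg_pi_lt_pi f p‖ ≤ B := by
  induction n with
  | zero =>
    intro f hf _
    have hc : Continuous f := hf.continuous
    refine ⟨|1 / (π - -π)| * ∫ x in -π..π, ‖f x‖, fun p => ?_⟩
    rw [pow_zero, one_mul, fourierCoeffOn_eq_integral, norm_smul, Real.norm_eq_abs]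
    refine mul_le_mul_of_nonneg_left ?_ (abs_nonneg _)
    refine (intervalIntegral.norm_integral_le_integral_norm neg_pi_lt_pi.le).trans_eq ?_
    refine intervalIntegral.integral_congr fun x _ => ?_
    simp only [norm_smul]
    rw [show ‖fourier (-p) (x : AddCircle (π - -π))‖ = 1 from Circle.norm_coe _, one_mul]
  | succ n ih =>
    intro f hf hper
    have hf' : ContDiff ℝ ((n : ℕ) + 1) f := by exact_mod_cast hf
    obtain ⟨hd, -, hd'⟩ := contDiff_succ_iff_deriv.1 hf'
    obtain ⟨B, hB⟩ := ih (deriv f) hd' fun x => by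
      rw [← deriv_comp_add_const]
      simp only [hper]
    refine ⟨B, fun p => ?_⟩
    rcases eq_or_ne p 0 with rfl | hp
    · have := hB 0
      simp only [Int.cast_zero, abs_zero, ne_eq, Nat.succ_ne_zero, not_false_eq_true, zero_pow,
        zero_mul]
      exact le_trans (by positivity) this
    · rw [fourierCoeffOn_of_hasDerivAt neg_pi_lt_pi hp (fun x _ => (hd x).hasDerivAt)
        (hd'.continuous.intervalIntegrable _ _)]
      have h1 : f π = f (-π) := by rw [← hper (-π)]; ring_nf
      have hp' : (0 : ℝ) < |(p : ℝ)| := abs_pos.2 (by exact_mod_cast hp)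
      have hpi := Real.pi_pos
      have h2 : ‖1 / (-2 * (π : ℂ) * I * p) * (fourier (-p) ((-π : ℝ) : AddCircle (π - -π)) *
          (f π - f (-π)) - ((π - -π : ℝ) : ℂ) * fourierCoeffOn neg_pi_lt_pi (deriv f) p)‖ =
          1 / |(p : ℝ)| * ‖fourierCoeffOn neg_pi_lt_pi (deriv f) p‖ := by
        rw [h1, sub_self, mul_zero, zero_sub, norm_mul, norm_neg, norm_mul, norm_div]
        simp only [norm_mul, norm_neg, Complex.norm_real, Complex.norm_I, norm_one,
          Complex.norm_intCast, Complex.norm_ofNat, Real.norm_eq_abs, abs_of_pos hpi]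
        rw [abs_of_pos (by linarith : 0 < π - -π)]
        field_simp
        ring
      push_cast at h2 ⊢
      rw [h2]
      refine le_trans (le_of_eq ?_) (hB p)
      field_simp
      ring

lemma continuous_phase {k : ℝ} (hk : k ∈ Ioo (0 : ℝ) 1) (m : ℤ) :
    Continuous fun θ => m * ellX k θ := continuous_const.mul (continuous_ellX hk)

lemma phase_odd (k : ℝ) (m : ℤ) (θ : ℝ) : m * ellX k (-θ) = -(m * ellX k θ) := by
  rw [ellX_neg]; ring

lemma exp_phase_periodic {k : ℝ} (hk : k ∈ Ioo (0 : ℝ) 1) (m : ℤ) (θ : ℝ) :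
    cexp (I * (m * ellX k (θ + 2 * π) : ℝ)) = cexp (I * (m * ellX k θ : ℝ)) := by
  rw [ellX_add_two_pi hk, Complex.exp_eq_exp_iff_exists_int]
  exact ⟨m, by push_cast; ring⟩

lemma exists_pow_mul_coefA_le {k : ℝ} (hk : k ∈ Ioo (0 : ℝ) 1) (m : ℤ) :
    ∃ B, ∀ p : ℤ, |(p : ℝ)| ^ 4 * |coefA k m p| ≤ B := by
  obtain ⟨B, hB⟩ := exists_pow_mul_fourierCoeffOn_le 4
    (fun θ => (((fun _ => 1 : ℝ → ℝ) θ : ℝ) : ℂ) * cexp (I * (m * ellX k θ : ℝ))) (by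
      refine contDiff_const.mul (ContDiff.cexp (contDiff_const.mul ?_))
      exact Complex.ofRealCLM.contDiff.comp (contDiff_const.mul (contDiff_ellX hk 3))) (by
      intro x
      rw [exp_phase_periodic hk])
  refine ⟨B, fun p => ?_⟩
  have := hB p
  rwa [fourierCoeffOn_eq_realFourier continuous_const (continuous_phase hk m) (fun _ => rfl)
    (phase_odd k m), Complex.norm_real] at this

lemma summable_pow_mul_coefA {k : ℝ} (hk : k ∈ Ioo (0 : ℝ) 1) (m : ℤ) {j : ℕ} (hj : j ≤ 2) :
    Summable fun p : ℤ => (p : ℝ) ^ j * coefA k m p := by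
  obtain ⟨B, hB⟩ := exists_pow_mul_coefA_le hk m
  have hs : Summable fun p : ℤ => B * (1 / (p : ℝ) ^ 2) :=
    (Real.summable_one_div_int_pow.2 one_lt_two).mul_left B
  refine Summable.of_norm_bounded_eventually hs ?_
  have : ∀ᶠ p : ℤ in Filter.cofinite, p ≠ 0 := by
    rw [Filter.eventually_cofinite]
    simp
  filter_upwards [this] with p hp
  have hp1 : (1 : ℝ) ≤ |(p : ℝ)| := by exact_mod_cast Int.one_le_abs hp
  rw [Real.norm_eq_abs, abs_mul, abs_pow, ← sq_abs (p : ℝ)]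
  have h2 : |(p : ℝ)| ^ j ≤ |(p : ℝ)| ^ 2 := pow_le_pow_right₀ hp1 hj
  have hpos : 0 < |(p : ℝ)| ^ 2 := by positivity
  rw [mul_one_div, le_div_iff₀ hpos]
  refine le_trans ?_ (hB p)
  calc |(p : ℝ)| ^ j * |coefA k m p| * |(p : ℝ)| ^ 2
      ≤ |(p : ℝ)| ^ 2 * |coefA k m p| * |(p : ℝ)| ^ 2 := by gcongr
    _ = _ := by ring

lemma hasSum_coefA {k : ℝ} (hk : k ∈ Ioo (0 : ℝ) 1) (m : ℤ) : HasSum (coefA k m) 1 := by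
  refine hasSum_realFourier_zero (A := fun _ => 1) continuous_const (continuous_phase hk m)
    (fun _ => rfl) (phase_odd k m) (fun x => ?_) ?_
  · rw [exp_phase_periodic hk]
  · simpa [coefA] using summable_pow_mul_coefA hk m (j := 0) (by norm_num)

lemma deltaAmp_zero (k : ℝ) : deltaAmp k 0 = kComp k := by
  simp [deltaAmp, kComp]

lemma hasSum_mul_coefA {k : ℝ} (hk : k ∈ Ioo (0 : ℝ) 1) {m : ℤ} (hm : m ≠ 0) :
    HasSum (fun p : ℤ => p * coefA k m p) (m * (ellC k / kComp k)) := by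
  have hm' : (m : ℝ) ≠ 0 := by exact_mod_cast hm
  have h1 : ∀ p : ℤ, coefB k m p 0 = 1 / m * (p * coefA k m p) := fun p => by
    rw [coefA_mul_eq hk]; field_simp
  have hs : Summable fun p => coefB k m p 0 := by
    simp only [h1]
    exact (by simpa using summable_pow_mul_coefA hk m (j := 1) (by norm_num) :
      Summable fun p : ℤ => p * coefA k m p).mul_left _
  have h := hasSum_realFourier_zero (A := fun θ => ellT k θ ^ 0 * (ellC k / deltaAmp k θ))
    (by simpa using continuous_inv_deltaAmp hk (ellC k)) (continuous_phase hk m)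
    (fun x => by simp [deltaAmp_neg]) (phase_odd k m) (fun x => by
      rw [exp_phase_periodic hk, show x + 2 * π = x + π + π by ring, deltaAmp_add_pi,
        deltaAmp_add_pi]
      simp) hs
  simp only [coefA_mul_eq hk]
  rw [← deltaAmp_zero]
  simpa [coefB] using h.mul_left (m : ℝ)

/-- The Dirichlet series `∑ g(p) exp(-p s)`. -/
def expSeries (g : ℤ → ℝ) (s : ℝ) : ℝ := ∑' p : ℤ, g p * Real.exp (-(p * s))

lemma exp_term_le {g : ℤ → ℝ} (h0 : ∀ p < 0, g p = 0) {s : ℝ} (hs : 0 ≤ s) (p : ℤ) :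
    ‖g p * Real.exp (-(p * s))‖ ≤ ‖g p‖ := by
  rcases lt_or_ge p 0 with hp | hp
  · simp [h0 p hp]
  · rw [norm_mul, Real.norm_eq_abs (Real.exp _), abs_of_pos (Real.exp_pos _)]
    refine mul_le_of_le_one_right (norm_nonneg _) (Real.exp_le_one_iff.2 ?_)
    have : (0 : ℝ) ≤ p := by exact_mod_cast hp
    nlinarith

lemma summable_expSeries {g : ℤ → ℝ} (h0 : ∀ p < 0, g p = 0) (hg : Summable g) {s : ℝ}
    (hs : 0 ≤ s) : Summable fun p : ℤ => g p * Real.exp (-(p * s)) :=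
  Summable.of_norm_bounded hg.norm (exp_term_le h0 hs)

lemma continuousOn_expSeries {g : ℤ → ℝ} (h0 : ∀ p < 0, g p = 0) (hg : Summable g) :
    ContinuousOn (expSeries g) (Ici 0) :=
  continuousOn_tsum (fun _ => Continuous.continuousOn (by fun_prop)) hg.norm
    fun p _ hs => exp_term_le h0 hs p

lemma hasDerivAt_expSeries {g : ℤ → ℝ} (h0 : ∀ p < 0, g p = 0) (hg : Summable g)
    (hg1 : Summable fun p : ℤ => p * g p) {s : ℝ} (hs : 0 < s) :
    HasDerivAt (expSeries g) (-expSeries (fun p => p * g p) s) s := by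
  have h := hasDerivAt_tsum_of_isPreconnected (u := fun p : ℤ => ‖p * g p‖) (t := Ioi 0)
    (g := fun (p : ℤ) s => g p * Real.exp (-(p * s)))
    (g' := fun (p : ℤ) s => -(p * g p * Real.exp (-(p * s)))) (y₀ := s) (y := s) hg1.norm
    isOpen_Ioi isPreconnected_Ioi (fun p y _ => ?_) (fun p y hy => ?_) hs
    (summable_expSeries h0 hg hs.le) hs
  · rw [tsum_neg] at h
    exact h
  · have := ((((hasDerivAt_id y).const_mul (p : ℝ)).neg).exp).const_mul (g p)
    exact this.congr_deriv (by simp; ring)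
  · rw [norm_neg]
    exact exp_term_le (g := fun p : ℤ => p * g p) (fun p hp => by simp [h0 p hp]) (le_of_lt hy) p

lemma eq_zero_of_hasSum {ι : Type*} {f : ι → ℝ} {a : ℝ} (h : HasSum f a) (hf : ∀ i, f i = 0) :
    a = 0 := by
  rw [funext hf] at h
  exact h.unique hasSum_zero

/-- The sequences of interest satisfy a three-term recurrence, hence the associated series a
second order differential equation. -/
lemma expSeries_ode {k c : ℝ} {f : ℤ → ℝ} (h0 : ∀ p < 0, f p = 0)
    (hs : ∀ j ≤ 2, Summable fun p : ℤ => (p : ℝ) ^ j * f p)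
    (hrec : ∀ p : ℤ, k ^ 2 / 4 * ((p - 2) * (p - 1) * f (p - 2) + (p + 2) * (p + 1) * f (p + 2)) +
      (c - (1 - k ^ 2 / 2) * p ^ 2) * f p = 0) {s : ℝ} (hs0 : 0 ≤ s) :
    (1 - k ^ 2 * Real.cosh s ^ 2) * expSeries (fun p => p * (p * f p)) s +
      k ^ 2 * Real.cosh s * Real.sinh s * expSeries (fun p => p * f p) s =
      c * expSeries f s := by
  have H : ∀ j ≤ 2, HasSum (fun p : ℤ => (p : ℝ) ^ j * f p * Real.exp (-(p * s)))
      (expSeries (fun p => (p : ℝ) ^ j * f p) s) := fun j hj =>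
    (summable_expSeries (fun p hp => by simp [h0 p hp]) (hs j hj) hs0).hasSum
  have S0 := H 0 (by norm_num)
  have S1 := H 1 (by norm_num)
  have S2 := H 2 le_rfl
  simp only [pow_zero, one_mul, pow_one] at S0 S1 S2
  have e2 : (fun p : ℤ => (p : ℝ) ^ 2 * f p) = fun p : ℤ => p * (p * f p) := by
    funext p; ring
  rw [e2] at S2
  set F0 := expSeries f s
  set F1 := expSeries (fun p => p * f p) s
  set F2 := expSeries (fun p => p * (p * f p)) s
  -- the two shifted series
  have Sp := ((Equiv.addRight (2 : ℤ)).hasSum_iff.2 (S2.sub S1)).mul_left (Real.exp (2 * s))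
  have Sm := ((Equiv.addRight (-2 : ℤ)).hasSum_iff.2 (S2.add S1)).mul_left (Real.exp (-(2 * s)))
  have T := ((S2.mul_left (1 - k ^ 2 / 2)).sub ((Sp.add Sm).mul_left (k ^ 2 / 4))).sub
    (S0.mul_left c)
  have hT := eq_zero_of_hasSum T fun p => by
    have e3 : Real.exp (-((p + 2) * s)) = Real.exp (-(p * s)) * Real.exp (-(2 * s)) := by
      rw [← Real.exp_add]; ring_nf
    have e4 : Real.exp (-((p - 2) * s)) = Real.exp (-(p * s)) * Real.exp (2 * s) := by
      rw [← Real.exp_add]; ring_nf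
    have e5 : Real.exp (2 * s) * Real.exp (-(2 * s)) = 1 := by
      rw [← Real.exp_add]; simp
    have := hrec p
    simp only [Function.comp_apply, Equiv.coe_addRight, ← sub_eq_add_neg]
    push_cast
    rw [e3, e4]
    linear_combination -Real.exp (-(p * s)) * this - (k ^ 2 / 4 * Real.exp (-(p * s)) *
      ((p - 2) * (p - 1) * f (p - 2) + (p + 2) * (p + 1) * f (p + 2))) * e5
  have c2 : Real.exp (2 * s) = Real.exp s ^ 2 := by rw [← Real.exp_nat_mul]; simp
  have c3 : Real.exp (-(2 * s)) = Real.exp (-s) ^ 2 := by rw [← Real.exp_nat_mul]; congr 1; simp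
  have c4 : Real.exp s * Real.exp (-s) = 1 := by rw [← Real.exp_add]; simp
  rw [c2, c3] at hT
  rw [Real.cosh_eq, Real.sinh_eq]
  linear_combination hT - k ^ 2 / 2 * F2 * c4

lemma kComp_mem {k : ℝ} (hk : k ∈ Ioo (0 : ℝ) 1) : kComp k ∈ Ioo (0 : ℝ) 1 := by
  have h1 : k ^ 2 < 1 := by nlinarith [hk.1, hk.2]
  refine ⟨Real.sqrt_pos.2 (by linarith), ?_⟩
  rw [kComp, Real.sqrt_lt' one_pos]
  nlinarith [hk.1]

lemma kComp_sq {k : ℝ} (hk : k ∈ Ioo (0 : ℝ) 1) : kComp k ^ 2 = 1 - k ^ 2 :=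
  Real.sq_sqrt (by nlinarith [hk.1, hk.2])

lemma ellX_pi_div_two {k : ℝ} (hk : k ∈ Ioo (0 : ℝ) 1) : ellX k (π / 2) = π / 2 := by
  have h := ellX_add_pi hk (-(π / 2))
  rw [ellX_neg, show -(π / 2) + π = π / 2 by ring] at h
  linarith

lemma eq_of_hasDerivAt_zero {Q : ℝ → ℝ} {a b : ℝ} (hab : a < b) (hc : ContinuousOn Q (Icc a b))
    (hd : ∀ x ∈ Ioo a b, HasDerivAt Q 0 x) : Q a = Q b := by
  obtain ⟨c, -, h⟩ := exists_hasDerivAt_eq_slope Q (fun _ => 0) hab hc hd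
  have : b - a ≠ 0 := by linarith
  field_simp at h
  linarith

lemma expSeries_connection {k m : ℝ} (hk : k ∈ Ioo (0 : ℝ) 1) {f : ℤ → ℝ}
    (h0 : ∀ p < 0, f p = 0) (hs : ∀ j ≤ 2, Summable fun p : ℤ => (p : ℝ) ^ j * f p)
    (hrec : ∀ p : ℤ, k ^ 2 / 4 * ((p - 2) * (p - 1) * f (p - 2) + (p + 2) * (p + 1) * f (p + 2)) +
      (m ^ 2 * ellC k ^ 2 - (1 - k ^ 2 / 2) * p ^ 2) * f p = 0) :
    m * ellC k * (∑' p, f p) - kComp k * ∑' p : ℤ, p * f p =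
      (m * ellC k * (∑' p, f p) + kComp k * ∑' p : ℤ, p * f p) *
        Real.exp (-(m * (π * (ellC k / ellC (kComp k))))) := by
  set k' := kComp k with hk'
  have hk'm : k' ∈ Ioo (0 : ℝ) 1 := kComp_mem hk
  have hk'2 : k' ^ 2 = 1 - k ^ 2 := kComp_sq hk
  set C := ellC k
  set ρ := C / ellC k' with hρ
  have hC' : 0 < ellC k' := ellC_pos hk'm
  have hk0 : 0 < k := hk.1
  set σ : ℝ → ℝ := fun ψ => Real.arsinh (k' / k * Real.sin ψ) with hσ
  set D : ℝ → ℝ := deltaAmp k' with hD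
  have hDpos : ∀ ψ, 0 < D ψ := deltaAmp_pos hk'm
  have hDsq : ∀ ψ, D ψ ^ 2 = k ^ 2 + k' ^ 2 * Real.sin ψ ^ 2 := fun ψ => by
    rw [hD, deltaAmp_sq hk'm, Real.cos_sq', hk'2]; ring
  have hcosh : ∀ ψ, Real.cosh (σ ψ) = D ψ / k := fun ψ => by
    rw [hσ, Real.cosh_arsinh, Real.sqrt_eq_iff_mul_self_eq_of_pos (div_pos (hDpos ψ) hk0)]
    have := hDsq ψ
    field_simp
    linear_combination this
  have hsinh : ∀ ψ, Real.sinh (σ ψ) = k' / k * Real.sin ψ := fun ψ => Real.sinh_arsinh _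
  have hσd : ∀ ψ, HasDerivAt σ (k' * Real.cos ψ / D ψ) ψ := fun ψ => by
    have h := ((Real.hasDerivAt_sin ψ).const_mul (k' / k)).arsinh
    refine h.congr_deriv ?_
    have h2 := hcosh ψ
    rw [hσ, Real.cosh_arsinh] at h2
    rw [h2, smul_eq_mul]
    have := hDpos ψ
    field_simp
  have hσ0 : ∀ ψ ∈ Icc 0 (π / 2), 0 ≤ σ ψ := fun ψ hψ => by
    refine Real.arsinh_nonneg_iff.2 (mul_nonneg (div_pos hk'm.1 hk0).le ?_)
    exact Real.sin_nonneg_of_nonneg_of_le_pi hψ.1 (by linarith [hψ.2, Real.pi_pos])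
  have hσpos : ∀ ψ ∈ Ioo 0 (π / 2), 0 < σ ψ := fun ψ hψ => by
    refine Real.arsinh_pos_iff.2 (mul_pos (div_pos hk'm.1 hk0) ?_)
    exact Real.sin_pos_of_pos_of_lt_pi hψ.1 (by linarith [hψ.2, Real.pi_pos])
  have hs0 : Summable f := by simpa using hs 0 (by norm_num)
  have hs1 : Summable fun p : ℤ => p * f p := by simpa using hs 1 (by norm_num)
  have hs2 : Summable fun p : ℤ => p * (p * f p) := by
    simpa [pow_two, mul_assoc] using hs 2 le_rfl
  have h01 : ∀ p < 0, (p : ℤ) * f p = 0 := fun p hp => by simp [h0 p hp]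
  set P : ℝ → ℝ := fun ψ => expSeries f (σ ψ) with hP
  set S : ℝ → ℝ := fun ψ => expSeries (fun p => p * f p) (σ ψ) with hS
  set V : ℝ → ℝ := fun ψ => -(k' * Real.cos ψ) * S ψ with hV
  have hσc : Continuous σ := continuous_iff_continuousAt.2 fun ψ => (hσd ψ).continuousAt
  have hPc : ContinuousOn P (Icc 0 (π / 2)) :=
    (continuousOn_expSeries h0 hs0).comp hσc.continuousOn hσ0
  have hVc : ContinuousOn V (Icc 0 (π / 2)) := ContinuousOn.mul (by fun_prop)
    ((continuousOn_expSeries h01 hs1).comp hσc.continuousOn hσ0)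
  have hPd : ∀ ψ ∈ Ioo 0 (π / 2), HasDerivAt P (V ψ / D ψ) ψ := fun ψ hψ => by
    refine ((hasDerivAt_expSeries h0 hs0 hs1 (hσpos ψ hψ)).comp ψ (hσd ψ)).congr_deriv ?_
    simp only [hV, hS]
    ring
  have hVd : ∀ ψ ∈ Ioo 0 (π / 2), HasDerivAt V (m ^ 2 * C ^ 2 * P ψ / D ψ) ψ := fun ψ hψ => by
    have h1 := (hasDerivAt_expSeries h01 hs1 hs2 (hσpos ψ hψ)).comp ψ (hσd ψ)
    have h2 := (((Real.hasDerivAt_cos ψ).const_mul k').neg).mul h1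
    refine h2.congr_deriv ?_
    have h3 := expSeries_ode h0 hs hrec (hσpos ψ hψ).le
    rw [hcosh, hsinh] at h3
    have hDp := hDpos ψ
    have hsq := hDsq ψ
    have hsc := Real.sin_sq_add_cos_sq ψ
    simp only [hP, Function.comp_apply, Pi.neg_apply]
    generalize expSeries f (σ ψ) = F0 at *
    generalize expSeries (fun p => p * f p) (σ ψ) = F1 at *
    generalize expSeries (fun p => p * (p * f p)) (σ ψ) = F2 at *
    field_simp at h3 ⊢
    rw [hsq] at h3
    linear_combination h3 + F2 * k' ^ 2 * hsc + F2 * hk'2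
  have hyd : ∀ (r ψ : ℝ), HasDerivAt (fun ψ => Real.exp (r * (ρ * ellX k' ψ)))
      (Real.exp (r * (ρ * ellX k' ψ)) * (r * (C / D ψ))) ψ := fun r ψ => by
    refine (((hasDerivAt_ellX hk'm ψ).const_mul ρ).const_mul r).exp.congr_deriv ?_
    have hDp := hDpos ψ
    rw [hρ, show deltaAmp k' ψ = D ψ from rfl]
    field_simp
  have hQ : ∀ r : ℝ, r ^ 2 = m ^ 2 →
      V 0 + r * C * P 0 = (V (π / 2) + r * C * P (π / 2)) * Real.exp (-r * (ρ * (π / 2))) := by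
    intro r hr
    have h := eq_of_hasDerivAt_zero (Q := fun ψ => (V ψ + r * C * P ψ) *
      Real.exp (-r * (ρ * ellX k' ψ))) (a := 0) (b := π / 2) (by positivity)
      ((hVc.add (hPc.const_smul (r * C))).mul (Continuous.continuousOn
        (continuous_iff_continuousAt.2 fun ψ => (hyd (-r) ψ).continuousAt)))
      (fun ψ hψ => by
        refine (((hVd ψ hψ).add ((hPd ψ hψ).const_mul (r * C))).mul (hyd (-r) ψ)).congr_deriv ?_
        have hDp := hDpos ψ
        simp only [Pi.add_apply]
        field_simp
        linear_combination -(P ψ * C ^ 2 * Real.exp (-(r * ρ * ellX k' ψ))) * hr)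
    simpa [ellX_zero, ellX_pi_div_two hk'm] using h
  have hσz : σ 0 = 0 := by simp [hσ]
  have hP0 : P 0 = ∑' p, f p := by simp [hP, hσz, expSeries]
  have hV0 : V 0 = -(k' * ∑' p : ℤ, p * f p) := by simp [hV, hS, hσz, expSeries]
  have hV1 : V (π / 2) = 0 := by simp [hV]
  have q1 := hQ m rfl
  have q2 := hQ (-m) (by ring)
  rw [hP0, hV0, hV1] at q1 q2
  have e1 : Real.exp (-(m * (π * ρ))) =
      Real.exp (-m * (ρ * (π / 2))) * Real.exp (-m * (ρ * (π / 2))) := by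
    rw [← Real.exp_add]; ring_nf
  have e2 : Real.exp (-(-m) * (ρ * (π / 2))) * Real.exp (-m * (ρ * (π / 2))) = 1 := by
    rw [← Real.exp_add]; simp
  rw [e1]
  linear_combination q1 + Real.exp (-m * (ρ * (π / 2))) ^ 2 * q2 -
    (m * C * P (π / 2) * Real.exp (-m * (ρ * (π / 2)))) * e2

lemma qNome_pow {k : ℝ} (hk : k ∈ Ioo (0 : ℝ) 1) (m : ℕ) :
    qNome k ^ m = Real.exp (-(m * (π * (ellC k / ellC (kComp k))))) := by
  rw [qNome, ← Real.exp_nat_mul]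
  have h1 := Kell_pos hk
  have h2 := Kell_pos (kComp_mem hk)
  congr 1
  rw [ellC, ellC]
  field_simp

lemma eq_zero_of_recurrence {k c : ℝ} (hk : k ∈ Ioo (0 : ℝ) 1) {u : ℤ → ℝ}
    (hrec : ∀ p : ℤ, k ^ 2 / 4 * ((p - 2) * (p - 1) * u (p - 2) + (p + 2) * (p + 1) * u (p + 2)) +
      (c - (1 - k ^ 2 / 2) * p ^ 2) * u p = 0) (h1 : u 1 = 0) (h2 : u 2 = 0) :
    ∀ p : ℤ, 1 ≤ p → u p = 0 := by
  have split : ∀ n : ℕ, 1 ≤ n → n = 1 ∨ n = 2 ∨ ∃ p : ℕ, 1 ≤ p ∧ n = p + 2 := fun n hn => by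
    by_cases h : n ≤ 2
    · omega
    · exact Or.inr (Or.inr ⟨n - 2, by omega, by omega⟩)
  have main : ∀ n : ℕ, 1 ≤ n → u n = 0 := by
    intro n
    induction n using Nat.strong_induction_on with
    | _ n ih =>
      intro hn
      rcases split n hn with rfl | rfl | ⟨p, hp, rfl⟩
      · exact_mod_cast h1
      · exact_mod_cast h2
      have h := hrec p
      have e1 : ((p : ℝ) - 2) * (p - 1) * u ((p : ℤ) - 2) = 0 := by
        rcases split p hp with rfl | rfl | ⟨j, hj, rfl⟩
        · simp
        · simp
        · have := ih j (by omega) hj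
          push_cast
          rw [add_sub_cancel_right, add_sub_cancel_right, this, mul_zero]
      push_cast at h ⊢
      rw [e1, ih p (by omega) hp] at h
      have hk0 := hk.1
      refine (mul_eq_zero.1 (?_ : k ^ 2 / 4 * ((p + 2) * (p + 1)) * u ((p : ℤ) + 2) = 0)).resolve_left
        (by positivity)
      linear_combination h
  intro p hp
  have := main p.toNat (by omega)
  rwa [Int.toNat_of_nonneg (by omega)] at this

lemma coefA_neg_recurrence {k : ℝ} (hk : k ∈ Ioo (0 : ℝ) 1) (m p : ℤ) :
    k ^ 2 / 4 * ((p - 2) * (p - 1) * coefA k m (-(p - 2)) +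
      (p + 2) * (p + 1) * coefA k m (-(p + 2))) +
      (m ^ 2 * ellC k ^ 2 - (1 - k ^ 2 / 2) * p ^ 2) * coefA k m (-p) = 0 := by
  have h := coefA_recurrence hk m (-p)
  rw [show -p - 2 = -(p + 2) by ring, show -p + 2 = -(p - 2) by ring] at h
  push_cast at h
  linear_combination h

/-- The reflection identity relating the Fourier coefficients at `p` and `-p` through the nome. -/
theorem coefA_neg {k : ℝ} (hk : k ∈ Ioo (0 : ℝ) 1) {m : ℕ} (hm : 1 ≤ m) {p : ℤ} (hp : 1 ≤ p) :
    coefA k m (-p) = -qNome k ^ m * coefA k m p := by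
  set a := coefA k m with ha
  have hC := ellC_pos hk
  have hk' := (kComp_mem hk).1
  have hm0 : (0 : ℝ) < m := by exact_mod_cast hm
  have hm' : (m : ℤ) ≠ 0 := by omega
  obtain ⟨s, r, hsr, hr⟩ : ∃ s r : ℤ, ((s = 1 ∧ r = 2) ∨ (s = 2 ∧ r = 1)) ∧ Odd ((m : ℤ) - r) := by
    rcases Int.even_or_odd (m : ℤ) with h | h
    · exact ⟨2, 1, Or.inr ⟨rfl, rfl⟩, h.sub_odd odd_one⟩
    · exact ⟨1, 2, Or.inl ⟨rfl, rfl⟩, h.sub_even even_two⟩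
  have hz : ∀ u : ℤ → ℝ, (∀ p : ℤ, k ^ 2 / 4 * ((p - 2) * (p - 1) * u (p - 2) +
      (p + 2) * (p + 1) * u (p + 2)) +
      (m ^ 2 * ellC k ^ 2 - (1 - k ^ 2 / 2) * p ^ 2) * u p = 0) → u s = 0 → u r = 0 →
      ∀ p : ℤ, 1 ≤ p → u p = 0 := by
    intro u hu h1 h2
    rcases hsr with ⟨rfl, rfl⟩ | ⟨rfl, rfl⟩
    · exact eq_zero_of_recurrence hk hu h1 h2
    · exact eq_zero_of_recurrence hk hu h2 h1
  have hr1 : a r = 0 := coefA_eq_zero_of_odd hk hr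
  have hr2 : a (-r) = 0 := coefA_eq_zero_of_odd hk (by
    rw [sub_neg_eq_add, show (m : ℤ) + r = m - r + 2 * r by ring]
    exact hr.add_even (even_two_mul r))
  have rec1 := coefA_recurrence hk m
  have rec2 := coefA_neg_recurrence hk m
  simp only [← ha, Int.cast_natCast] at rec1 rec2
  have hprop : ∀ p : ℤ, 1 ≤ p → a s * a (-p) - a (-s) * a p = 0 :=
    hz (fun p => a s * a (-p) - a (-s) * a p)
      (fun p => by linear_combination a s * rec2 p - a (-s) * rec1 p) (by ring)
      (by simp [hr1, hr2])
  set f : ℤ → ℝ := fun p => a s * a p - a (-s) * a (-p) with hf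
  have hs2 : ∀ j ≤ 2, Summable fun p : ℤ => (p : ℝ) ^ j * f p := by
    intro j hj
    have h1 : Summable fun p : ℤ => (p : ℝ) ^ j * a p := summable_pow_mul_coefA hk m hj
    have h2 := ((Equiv.neg ℤ).summable_iff.2 h1).mul_left (a (-s) * (-1) ^ j)
    refine ((h1.mul_left (a s)).sub h2).congr fun p => ?_
    have : (-1 : ℝ) ^ j * (-1) ^ j = 1 := by rw [← mul_pow]; simp
    have e : (-(p : ℝ)) ^ j = (-1) ^ j * p ^ j := by rw [← mul_pow]; simp
    simp only [Function.comp_apply, Equiv.neg_apply, Int.cast_neg, hf, e]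
    linear_combination (-(a (-s) * p ^ j * a (-p))) * this
  have hconn := expSeries_connection (m := m) hk (f := f) (fun p hp => by
    have := hprop (-p) (by omega)
    rw [neg_neg] at this
    exact this) hs2 (fun p => by
    simp only [hf]
    linear_combination a s * rec1 p - a (-s) * rec2 p)
  have A0 : HasSum a 1 := hasSum_coefA hk m
  have A1 : HasSum (fun p : ℤ => p * a p) (m * (ellC k / kComp k)) := hasSum_mul_coefA hk hm'
  have B0 := (Equiv.neg ℤ).hasSum_iff.2 A0
  have B1 := (Equiv.neg ℤ).hasSum_iff.2 A1
  have F0 : ∑' p, f p = a s - a (-s) :=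
    ((A0.mul_left (a s)).sub (B0.mul_left (a (-s)))).tsum_eq.trans (by ring)
  have F1 : ∑' p : ℤ, p * f p = (a s + a (-s)) * (m * (ellC k / kComp k)) := by
    refine (tsum_congr fun p => ?_).trans
      (((A1.mul_left (a s)).add (B1.mul_left (a (-s)))).tsum_eq.trans (by ring))
    simp only [hf, Function.comp_apply, Equiv.neg_apply, Int.cast_neg]
    ring
  rw [F0, F1, ← qNome_pow hk] at hconn
  have hs' : a (-s) = -qNome k ^ m * a s := by
    have : 2 * m * ellC k ≠ 0 := by positivity
    refine mul_left_cancel₀ this ?_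
    have e : kComp k * (ellC k / kComp k) = ellC k := by field_simp
    linear_combination -hconn - m * (a s + a (-s)) * (1 + qNome k ^ m) * e
  have := hz (fun p => a (-p) + qNome k ^ m * a p)
    (fun p => by linear_combination rec2 p + qNome k ^ m * rec1 p)
    (by simp only [hs']; ring) (by simp [hr1, hr2]) p hp
  linear_combination this

lemma qNome_mem {k : ℝ} (hk : k ∈ Ioo (0 : ℝ) 1) : qNome k ∈ Ioo (0 : ℝ) 1 := by
  refine ⟨Real.exp_pos _, ?_⟩
  rw [qNome, Real.exp_lt_one_iff, neg_mul, neg_div, neg_lt_zero]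
  exact div_pos (mul_pos Real.pi_pos (Kell_pos (kComp_mem hk))) (Kell_pos hk)

lemma coefA_zero_left {k : ℝ} (hk : k ∈ Ioo (0 : ℝ) 1) {p : ℤ} (hp : p ≠ 0) : coefA k 0 p = 0 := by
  have h := coefA_mul_eq hk 0 p
  simpa [hp] using h

lemma coefB_zero_right {k : ℝ} (hk : k ∈ Ioo (0 : ℝ) 1) {m : ℤ} (hm : m ≠ 0) :
    coefB k m 0 0 = 0 := by
  have h := coefA_mul_eq hk m 0
  simpa [hm] using h.symm

lemma coefB_neg {k : ℝ} (hk : k ∈ Ioo (0 : ℝ) 1) {m : ℕ} (hm : 1 ≤ m) {p : ℤ} (hp : 1 ≤ p) :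
    coefB k m (-p) 0 = qNome k ^ m * coefB k m p 0 := by
  have h1 := coefA_mul_eq hk m p
  have h2 := coefA_mul_eq hk m (-p)
  rw [coefA_neg hk hm hp] at h2
  have hm' : ((m : ℤ) : ℝ) ≠ 0 := by positivity
  apply mul_left_cancel₀ hm'
  push_cast at h1 h2 ⊢
  linear_combination -h2 + qNome k ^ m * h1

lemma integral_inv_deltaAmp_symm {k : ℝ} (hk : k ∈ Ioo (0 : ℝ) 1) :
    ∫ θ in -π..π, ellC k / deltaAmp k θ = 2 * π := by
  have h := intervalIntegral.integral_eq_sub_of_hasDerivAt (a := -π) (b := π)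
    (fun θ _ => hasDerivAt_ellX hk θ) ((continuous_inv_deltaAmp hk (ellC k)).intervalIntegrable _ _)
  rw [h, ellX_neg, ellX_pi hk]; ring

lemma hasSum_coefA_mul_coefB {k : ℝ} (hk : k ∈ Ioo (0 : ℝ) 1) (m : ℤ) :
    HasSum (fun p => coefA k m p * coefB k m p 0) 1 := by
  have hi := continuous_inv_deltaAmp hk (ellC k)
  have h := hasSum_realFourier_mul (A₁ := fun _ => 1)
    (A₂ := fun θ => ellT k θ ^ 0 * (ellC k / deltaAmp k θ)) (ψ₁ := fun θ => m * ellX k θ)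
    (ψ₂ := fun θ => m * ellX k θ) continuous_const (by simpa using hi) (continuous_phase hk m)
    (continuous_phase hk m) (fun _ => rfl) (fun θ => by simp [deltaAmp_neg])
    (phase_odd k m) (phase_odd k m)
  simp only [pow_zero, one_mul, sub_self, Real.cos_zero, mul_one,
    integral_inv_deltaAmp_symm hk] at h
  rw [one_div, inv_mul_cancel₀ Real.two_pi_pos.ne'] at h
  simpa only [coefA, coefB, pow_zero, one_mul] using h

lemma hasSum_coefB_sq {k : ℝ} (hk : k ∈ Ioo (0 : ℝ) 1) (m : ℤ) :
    HasSum (fun p => coefB k m p 0 ^ 2)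
      (1 / (2 * π) * ∫ θ in -π..π, (ellC k / deltaAmp k θ) ^ 2) := by
  have hi := continuous_inv_deltaAmp hk (ellC k)
  have h := hasSum_realFourier_mul (A₁ := fun θ => ellT k θ ^ 0 * (ellC k / deltaAmp k θ))
    (A₂ := fun θ => ellT k θ ^ 0 * (ellC k / deltaAmp k θ)) (ψ₁ := fun θ => m * ellX k θ)
    (ψ₂ := fun θ => m * ellX k θ) (by simpa using hi) (by simpa using hi) (continuous_phase hk m)
    (continuous_phase hk m) (fun θ => by simp [deltaAmp_neg]) (fun θ => by simp [deltaAmp_neg])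
    (phase_odd k m) (phase_odd k m)
  simp only [pow_zero, one_mul, sub_self, Real.cos_zero, mul_one, ← sq] at h
  simpa only [coefB, pow_zero, one_mul] using h

lemma integral_comp_ellXInv {k : ℝ} (hk : k ∈ Ioo (0 : ℝ) 1) {G : ℝ → ℝ} (hG : Continuous G) :
    ∫ θ in -π..π, G θ * (ellC k / deltaAmp k θ) = ∫ x in -π..π, G (ellXInv hk x) := by
  have h := intervalIntegral.integral_comp_mul_deriv (a := -π) (b := π)
    (g := fun x => G (ellXInv hk x)) (fun θ _ => hasDerivAt_ellX hk θ)
    (continuous_inv_deltaAmp hk (ellC k)).continuousOn (hG.comp (ellXInv hk).continuous)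
  simpa only [Function.comp, ellXInv_ellX, ellX_neg, ellX_pi hk] using h

lemma coefB_eq_realFourier {k : ℝ} (hk : k ∈ Ioo (0 : ℝ) 1) (m X : ℤ) (Y : ℕ) :
    coefB k m X Y =
      realFourier (fun x => ellT k (ellXInv hk x) ^ Y) (fun x => X * ellXInv hk x) m := by
  have hx := continuous_ellX hk
  have hT := continuous_ellT (k := k)
  have h := integral_comp_ellXInv hk
    (G := fun θ => ellT k θ ^ Y * Real.cos (X * θ - m * ellX k θ)) (by fun_prop)
  simp only [ellX_ellXInv] at h
  rw [realFourier, ← h, coefB, realFourier]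
  congr 2
  funext θ
  rw [← Real.cos_neg (m * ellX k θ - X * θ), neg_sub]
  ring

lemma coefA_eq_realFourier {k : ℝ} (hk : k ∈ Ioo (0 : ℝ) 1) (m p : ℤ) :
    coefA k m p = realFourier (fun x => deltaAmp k (ellXInv hk x) / ellC k)
      (fun x => p * ellXInv hk x) m := by
  have hx := continuous_ellX hk
  have hT := continuous_deltaAmp k
  have h := integral_comp_ellXInv hk
    (G := fun θ => deltaAmp k θ / ellC k * Real.cos (p * θ - m * ellX k θ)) (by fun_prop)
  simp only [ellX_ellXInv] at h
  rw [realFourier, ← h, coefA_eq]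
  congr 2
  funext θ
  have h1 := (deltaAmp_pos hk θ).ne'
  have h2 := (ellC_pos hk).ne'
  rw [← Real.cos_neg (m * ellX k θ - p * θ), neg_sub]
  field_simp

lemma hasSum_coefA_mul_coefB_left {k : ℝ} (hk : k ∈ Ioo (0 : ℝ) 1) (l p : ℤ) :
    HasSum (fun m => coefA k m l * coefB k m p 0) (if l = p then 1 else 0) := by
  have hΘ : Continuous (ellXInv hk) := (ellXInv hk).continuous
  have hT := continuous_deltaAmp k
  have ho : ∀ (j : ℤ) (x : ℝ), j * ellXInv hk (-x) = -(j * ellXInv hk x) := fun j x => by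
    rw [ellXInv_neg]; ring
  have h := hasSum_realFourier_mul (A₁ := fun x => deltaAmp k (ellXInv hk x) / ellC k)
    (A₂ := fun x => ellT k (ellXInv hk x) ^ 0) (ψ₁ := fun x => l * ellXInv hk x)
    (ψ₂ := fun x => p * ellXInv hk x) (by fun_prop) (by simpa using continuous_const)
    (by fun_prop) (by fun_prop) (fun x => by rw [ellXInv_neg, deltaAmp_neg])
    (fun x => by simp) (ho l) (ho p)
  have hG := integral_comp_ellXInv hk
    (G := fun θ => deltaAmp k θ / ellC k * Real.cos (l * θ - p * θ)) (by fun_prop)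
  simp only [pow_zero, mul_one] at h
  rw [← hG] at h
  have e : ∀ θ, deltaAmp k θ / ellC k * Real.cos (l * θ - p * θ) * (ellC k / deltaAmp k θ) =
      Real.cos ((l - p) * θ) := fun θ => by
    have h1 := (deltaAmp_pos hk θ).ne'
    have h2 := (ellC_pos hk).ne'
    rw [← sub_mul]
    field_simp
  simp only [e] at h
  have hval : 1 / (2 * π) * ∫ θ in -π..π, Real.cos ((l - p) * θ) = if l = p then 1 else 0 := by
    split_ifs with hlp
    · subst hlp
      simp only [sub_self, zero_mul, Real.cos_zero, intervalIntegral.integral_const, smul_eq_mul,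
        mul_one, sub_neg_eq_add, ← two_mul]
      rw [one_div, inv_mul_cancel₀ Real.two_pi_pos.ne']
    · have hne : ((l : ℝ) - p) ≠ 0 := by exact_mod_cast sub_ne_zero.2 hlp
      rw [intervalIntegral.integral_comp_mul_left _ hne, integral_cos]
      have hs : Real.sin (((l : ℝ) - p) * π) = 0 := by exact_mod_cast Real.sin_int_mul_pi (l - p)
      simp [hs]
  rw [hval] at h
  simpa only [coefA_eq_realFourier hk, coefB_eq_realFourier hk, pow_zero] using h

lemma hasSum_coefB_sq_left {k : ℝ} (hk : k ∈ Ioo (0 : ℝ) 1) (X : ℤ) (Y : ℕ) :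
    ∃ s ≤ 1, HasSum (fun m => coefB k m X Y ^ 2) s := by
  have hΘ : Continuous (ellXInv hk) := (ellXInv hk).continuous
  have hT := continuous_ellT (k := k)
  have ho : ∀ (j : ℤ) (x : ℝ), j * ellXInv hk (-x) = -(j * ellXInv hk x) := fun j x => by
    rw [ellXInv_neg]; ring
  have h := hasSum_realFourier_mul (A₁ := fun x => ellT k (ellXInv hk x) ^ Y)
    (A₂ := fun x => ellT k (ellXInv hk x) ^ Y) (ψ₁ := fun x => X * ellXInv hk x)
    (ψ₂ := fun x => X * ellXInv hk x) (by fun_prop) (by fun_prop)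
    (by fun_prop) (by fun_prop) (fun x => by rw [ellXInv_neg, ellT_neg])
    (fun x => by rw [ellXInv_neg, ellT_neg]) (ho X) (ho X)
  simp only [sub_self, Real.cos_zero, mul_one, ← sq, ← coefB_eq_realFourier hk] at h
  refine ⟨_, ?_, h⟩
  have hle : ∫ x in -π..π, (ellT k (ellXInv hk x) ^ Y) ^ 2 ≤ ∫ x in -π..π, (1 : ℝ) := by
    refine intervalIntegral.integral_mono_on neg_pi_lt_pi.le
      (Continuous.intervalIntegrable (by fun_prop) _ _) (by simp) fun x _ => ?_
    rw [← sq_abs, abs_pow]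
    exact pow_le_one₀ (by positivity) (pow_le_one₀ (abs_nonneg _) (abs_ellT_le_one hk _))
  rw [intervalIntegral.integral_const, smul_eq_mul, mul_one, sub_neg_eq_add, ← two_mul] at hle
  rw [one_div, inv_mul_le_iff₀ Real.two_pi_pos, mul_one]
  exact hle

lemma coefB_add_coefB {k : ℝ} (hk : k ∈ Ioo (0 : ℝ) 1) (m X : ℤ) (Y : ℕ) :
    coefB k m (X + 1) Y + coefB k m (X - 1) Y =
      realFourier (fun θ => 2 * Real.cos θ * (ellT k θ ^ Y * (ellC k / deltaAmp k θ)))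
        (fun θ => m * ellX k θ) X := by
  have hx := continuous_ellX hk
  have hi := continuous_inv_deltaAmp hk (ellC k)
  have hT := continuous_ellT (k := k)
  rw [coefB, coefB, realFourier, realFourier, realFourier, ← mul_add,
    ← intervalIntegral.integral_add]
  · congr 2
    funext θ
    have e1 : m * ellX k θ - ((X + 1 : ℤ) : ℝ) * θ = (m * ellX k θ - X * θ) - θ := by
      push_cast; ring
    have e2 : m * ellX k θ - ((X - 1 : ℤ) : ℝ) * θ = (m * ellX k θ - X * θ) + θ := by
      push_cast; ring
    rw [e1, e2, Real.cos_sub, Real.cos_add]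
    ring
  · exact Continuous.intervalIntegrable (by fun_prop) _ _
  · exact Continuous.intervalIntegrable (by fun_prop) _ _

lemma coefB_harmonic {k : ℝ} (hk : k ∈ Ioo (0 : ℝ) 1) (m X : ℤ) (Y : ℕ) :
    k / 4 * (coefB k m (X + 1) (Y + 2) + coefB k m (X - 1) (Y + 2) +
      (coefB k m (X + 1) Y + coefB k m (X - 1) Y)) = coefB k m X (Y + 1) := by
  have hx := continuous_ellX hk
  have hi := continuous_inv_deltaAmp hk (ellC k)
  have hT := continuous_ellT (k := k)
  rw [coefB_add_coefB hk, coefB_add_coefB hk, coefB, realFourier, realFourier, realFourier,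
    ← mul_add, ← intervalIntegral.integral_add, mul_left_comm,
    ← intervalIntegral.integral_const_mul]
  · congr 2
    funext θ
    linear_combination (ellT k θ ^ Y * (ellC k / deltaAmp k θ) *
      Real.cos (m * ellX k θ - X * θ)) * ellT_quadratic hk θ
  · exact Continuous.intervalIntegrable (by fun_prop) _ _
  · exact Continuous.intervalIntegrable (by fun_prop) _ _

lemma coefB_harmonic_axis {k : ℝ} (hk : k ∈ Ioo (0 : ℝ) 1) (m X : ℤ) :
    k / 4 * (coefB k m (X + 1) 1 + coefB k m (X - 1) 1) =
      (coefB k m X 0 - ellC k * coefA k m X) / 2 := by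
  have hx := continuous_ellX hk
  have hi := continuous_inv_deltaAmp hk (ellC k)
  have hT := continuous_ellT (k := k)
  have key : (∫ θ in -π..π, k / 4 * (2 * Real.cos θ * (ellT k θ ^ 1 * (ellC k / deltaAmp k θ)) *
      Real.cos (m * ellX k θ - X * θ))) =
      ((∫ θ in -π..π, ellT k θ ^ 0 * (ellC k / deltaAmp k θ) * Real.cos (m * ellX k θ - X * θ)) -
        ellC k * ∫ θ in -π..π, Real.cos (m * ellX k θ - X * θ)) / 2 := by
    rw [← intervalIntegral.integral_const_mul, ← intervalIntegral.integral_sub,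
      ← intervalIntegral.integral_div]
    · congr 1
      funext θ
      have h1 := (deltaAmp_pos hk θ).ne'
      have h2 : ellC k = deltaAmp k θ * (ellC k / deltaAmp k θ) := by field_simp
      linear_combination (ellC k / deltaAmp k θ *
        Real.cos (m * ellX k θ - X * θ)) * ellT_mul_cos hk θ +
        (1 / 2) * Real.cos (m * ellX k θ - X * θ) * h2
    · exact Continuous.intervalIntegrable (by fun_prop) _ _
    · exact Continuous.intervalIntegrable (by fun_prop) _ _
  rw [coefB_add_coefB hk, coefA_eq, coefB, realFourier, realFourier, mul_left_comm,
    ← intervalIntegral.integral_const_mul, key]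
  ring

lemma coefA_mul_coefB_neg {k : ℝ} (hk : k ∈ Ioo (0 : ℝ) 1) (m p : ℕ) (hm : m ≠ 0) :
    coefA k m (-p) * coefB k m (-p) 0 = -(qNome k ^ m) ^ 2 * (coefA k m p * coefB k m p 0) := by
  rcases Nat.eq_zero_or_pos p with rfl | hp
  · simp [coefB_zero_right hk (Int.natCast_ne_zero.2 hm)]
  · have hp' : (1 : ℤ) ≤ p := by exact_mod_cast hp
    have hm' : 1 ≤ m := Nat.one_le_iff_ne_zero.2 hm
    rw [coefA_neg hk hm' hp', coefB_neg hk hm' hp']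
    ring

lemma hasSum_nat_coefA_mul_coefB {k : ℝ} (hk : k ∈ Ioo (0 : ℝ) 1) {m : ℕ} (hm : m ≠ 0) :
    HasSum (fun p : ℕ => (1 - (qNome k ^ m) ^ 2) * (coefA k m p * coefB k m p 0)) 1 := by
  have h := (hasSum_coefA_mul_coefB hk m).nat_add_neg
  rw [coefB_zero_right hk (Int.natCast_ne_zero.2 hm), mul_zero, add_zero] at h
  refine h.congr_fun fun p => ?_
  rw [coefA_mul_coefB_neg hk m p hm]
  ring

lemma hasSum_nat_coefA_mul_coefB_left {k : ℝ} (hk : k ∈ Ioo (0 : ℝ) 1) {l p : ℤ} (hl : 1 ≤ l)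
    (hp : 1 ≤ p) :
    HasSum (fun m : ℕ => (1 - (qNome k ^ m) ^ 2) * (coefA k m l * coefB k m p 0))
      (if l = p then 1 else 0) := by
  have h := (hasSum_coefA_mul_coefB_left hk l p).nat_add_neg
  rw [coefA_zero_left hk (by omega), zero_mul, add_zero] at h
  refine h.congr_fun fun m => ?_
  rcases Nat.eq_zero_or_pos m with rfl | hm
  · simp [coefA_zero_left hk (show l ≠ 0 by omega)]
  · have e1 : coefA k (-m) l = coefA k m (-l) := by rw [← coefA_neg_neg, neg_neg]
    have e2 : coefB k (-m) p 0 = coefB k m (-p) 0 := by rw [← coefB_neg_neg, neg_neg]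
    rw [e1, e2, coefA_neg hk hm hl, coefB_neg hk hm hp]
    ring

/-- The spectral weight of the `m`-th mode in the Green function with pole at `p`. -/
def modeWeight (k : ℝ) (p : ℤ) (m : ℕ) : ℝ :=
  (1 - (qNome k ^ m) ^ 2) * coefB k m p 0 / ellC k

/-- Superposition of the separated harmonic functions with decay `q ^ (m i)` in the angle. -/
def modeSum (k : ℝ) (p : ℤ) (i : ℕ) (X : ℤ) (Y : ℕ) : ℝ :=
  ∑' m : ℕ, modeWeight k p m * (qNome k ^ m) ^ i * coefB k m X Y

/-- The normal derivative of `modeSum` on the axis. -/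
def modeFlux (k : ℝ) (p : ℤ) (i : ℕ) (X : ℤ) : ℝ :=
  ∑' m : ℕ, modeWeight k p m * (qNome k ^ m) ^ i * coefA k m X

lemma qNome_pow_mem {k : ℝ} (hk : k ∈ Ioo (0 : ℝ) 1) (m : ℕ) : qNome k ^ m ∈ Ioc (0 : ℝ) 1 :=
  ⟨pow_pos (qNome_mem hk).1 _, pow_le_one₀ (qNome_mem hk).1.le (qNome_mem hk).2.le⟩

lemma summable_coefB_sq_nat {k : ℝ} (hk : k ∈ Ioo (0 : ℝ) 1) (X : ℤ) (Y : ℕ) :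
    Summable (fun m : ℕ => coefB k m X Y ^ 2) ∧ ∑' m : ℕ, coefB k m X Y ^ 2 ≤ 1 := by
  obtain ⟨s, hs, h⟩ := hasSum_coefB_sq_left hk X Y
  have h1 : Summable (fun m : ℕ => coefB k m X Y ^ 2) :=
    h.summable.comp_injective Nat.cast_injective
  refine ⟨h1, le_trans ?_ hs⟩
  rw [← h.tsum_eq]
  exact h1.tsum_le_tsum_of_inj _ Nat.cast_injective (fun _ _ => sq_nonneg _) (fun _ => le_rfl)
    h.summable

lemma abs_modeSum_term_le {k : ℝ} (hk : k ∈ Ioo (0 : ℝ) 1) (p : ℤ) (i : ℕ) (X : ℤ) (Y m : ℕ) :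
    |modeWeight k p m * (qNome k ^ m) ^ i * coefB k m X Y| ≤
      (1 / ellC k) * ((coefB k m p 0 ^ 2 + coefB k m X Y ^ 2) / 2) := by
  obtain ⟨h0, h1⟩ := qNome_pow_mem hk m
  have hC := ellC_pos hk
  have hi : (qNome k ^ m) ^ i ≤ 1 := pow_le_one₀ h0.le h1
  have hi0 : 0 < (qNome k ^ m) ^ i := pow_pos h0 _
  have e : modeWeight k p m * (qNome k ^ m) ^ i * coefB k m X Y =
      ((1 - (qNome k ^ m) ^ 2) * (qNome k ^ m) ^ i) * (1 / ellC k) *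
        (coefB k m p 0 * coefB k m X Y) := by
    rw [modeWeight]; ring
  have hw : (1 - (qNome k ^ m) ^ 2) * (qNome k ^ m) ^ i ≤ 1 :=
    mul_le_one₀ (by nlinarith) hi0.le hi
  have hw0 : 0 ≤ (1 - (qNome k ^ m) ^ 2) * (qNome k ^ m) ^ i :=
    mul_nonneg (by nlinarith) hi0.le
  have h2 : |coefB k m p 0 * coefB k m X Y| ≤ (coefB k m p 0 ^ 2 + coefB k m X Y ^ 2) / 2 := by
    rw [abs_le]
    constructor <;> nlinarith [sq_nonneg (coefB k m p 0 + coefB k m X Y),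
      sq_nonneg (coefB k m p 0 - coefB k m X Y)]
  rw [e, abs_mul, abs_of_nonneg (mul_nonneg hw0 (by positivity))]
  refine mul_le_mul ?_ h2 (abs_nonneg _) (by positivity)
  exact mul_le_of_le_one_left (by positivity) hw

lemma summable_modeSum_bound {k : ℝ} (hk : k ∈ Ioo (0 : ℝ) 1) (p X : ℤ) (Y : ℕ) :
    Summable fun m : ℕ => (1 / ellC k) * ((coefB k m p 0 ^ 2 + coefB k m X Y ^ 2) / 2) :=
  (((summable_coefB_sq_nat hk p 0).1.add (summable_coefB_sq_nat hk X Y).1).div_const 2).mul_left _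

lemma summable_modeSum {k : ℝ} (hk : k ∈ Ioo (0 : ℝ) 1) (p : ℤ) (i : ℕ) (X : ℤ) (Y : ℕ) :
    Summable fun m : ℕ => modeWeight k p m * (qNome k ^ m) ^ i * coefB k m X Y :=
  .of_norm_bounded (summable_modeSum_bound hk p X Y) fun m => abs_modeSum_term_le hk p i X Y m

lemma abs_modeSum_le {k : ℝ} (hk : k ∈ Ioo (0 : ℝ) 1) (p : ℤ) (i : ℕ) (X : ℤ) (Y : ℕ) :
    |modeSum k p i X Y| ≤ 1 / ellC k := by
  have hC := ellC_pos hk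
  have h : |modeSum k p i X Y| ≤ _ :=
    tsum_of_norm_bounded (f := fun m : ℕ => modeWeight k p m * (qNome k ^ m) ^ i * coefB k m X Y)
      (summable_modeSum_bound hk p X Y).hasSum fun m => abs_modeSum_term_le hk p i X Y m
  refine h.trans ?_
  have hp := summable_coefB_sq_nat hk p 0
  have hX := summable_coefB_sq_nat hk X Y
  rw [tsum_mul_left, tsum_div_const, hp.1.tsum_add hX.1]
  exact mul_le_of_le_one_right (by positivity) (by linarith [hp.2, hX.2])

lemma modeWeight_zero (k : ℝ) (p : ℤ) : modeWeight k p 0 = 0 := by simp [modeWeight]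

lemma modeSum_axis_neg {k : ℝ} (hk : k ∈ Ioo (0 : ℝ) 1) (p : ℤ) (i : ℕ) {X : ℤ} (hX : 1 ≤ X) :
    modeSum k p i (-X) 0 = modeSum k p (i + 1) X 0 := by
  refine tsum_congr fun m => ?_
  rcases Nat.eq_zero_or_pos m with rfl | hm
  · simp [modeWeight_zero]
  · rw [coefB_neg hk hm hX]; ring

lemma modeSum_axis_zero {k : ℝ} (hk : k ∈ Ioo (0 : ℝ) 1) (p : ℤ) (i : ℕ) :
    modeSum k p i 0 0 = 0 := by
  refine (tsum_congr fun m => ?_).trans tsum_zero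
  rcases Nat.eq_zero_or_pos m with rfl | hm
  · simp [modeWeight_zero]
  · rw [coefB_zero_right hk (by omega), mul_zero]

lemma modeFlux_neg {k : ℝ} (hk : k ∈ Ioo (0 : ℝ) 1) (p : ℤ) (i : ℕ) {X : ℤ} (hX : 1 ≤ X) :
    modeFlux k p i (-X) = -modeFlux k p (i + 1) X := by
  rw [modeFlux, modeFlux, ← tsum_neg]
  refine tsum_congr fun m => ?_
  rcases Nat.eq_zero_or_pos m with rfl | hm
  · simp [modeWeight_zero]
  · rw [coefA_neg hk hm hX]; ring

lemma modeFlux_pole {k : ℝ} (hk : k ∈ Ioo (0 : ℝ) 1) {p X : ℤ} (hp : 1 ≤ p) (hX : 1 ≤ X) :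
    ellC k * modeFlux k p 0 X = if X = p then 1 else 0 := by
  have hC := (ellC_pos hk).ne'
  rw [modeFlux, ← tsum_mul_left, ← (hasSum_nat_coefA_mul_coefB_left hk hX hp).tsum_eq]
  refine tsum_congr fun m => ?_
  rw [modeWeight]
  field_simp

lemma modeSum_harmonic {k : ℝ} (hk : k ∈ Ioo (0 : ℝ) 1) (p : ℤ) (i : ℕ) (X : ℤ) (Y : ℕ) :
    k / 4 * (modeSum k p i (X + 1) (Y + 2) + modeSum k p i (X - 1) (Y + 2) +
      (modeSum k p i (X + 1) Y + modeSum k p i (X - 1) Y)) = modeSum k p i X (Y + 1) := by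
  have hs := fun X Y => (summable_modeSum hk p i X Y).hasSum
  have h := ((((hs (X + 1) (Y + 2)).add (hs (X - 1) (Y + 2))).add
    ((hs (X + 1) Y).add (hs (X - 1) Y))).mul_left (k / 4))
  refine h.tsum_eq.symm.trans (tsum_congr fun m => ?_)
  linear_combination (modeWeight k p m * (qNome k ^ m) ^ i) * coefB_harmonic hk m X Y

lemma modeSum_harmonic_axis {k : ℝ} (hk : k ∈ Ioo (0 : ℝ) 1) (p : ℤ) (i : ℕ) (X : ℤ) :
    k / 4 * (modeSum k p i (X + 1) 1 + modeSum k p i (X - 1) 1) =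
      (modeSum k p i X 0 - ellC k * modeFlux k p i X) / 2 := by
  have hC := (ellC_pos hk).ne'
  have hs := fun X Y => (summable_modeSum hk p i X Y).hasSum
  have h := ((hs (X + 1) 1).add (hs (X - 1) 1)).mul_left (k / 4)
  have h2 := (hs X 0).sub (h.mul_left 2)
  have h3 : modeFlux k p i X = (modeSum k p i X 0 -
      2 * (k / 4 * (modeSum k p i (X + 1) 1 + modeSum k p i (X - 1) 1))) / ellC k := by
    refine Eq.trans (tsum_congr fun m => ?_) (h2.div_const (ellC k)).tsum_eq
    have := coefB_harmonic_axis hk m X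
    rw [eq_div_iff hC]
    linear_combination (2 * modeWeight k p m * (qNome k ^ m) ^ i) * this
  rw [h3]
  field_simp
  ring

/-- The distance of the half-plane sector `j` from the pole, which lies between sectors `-1`
and `0`. -/
def sectorIdx (j : ℤ) : ℕ := if 0 ≤ j then j.toNat else (-1 - j).toNat

/-- The Green function on the `j`-th half-plane sheet of the universal cover. -/
def sectorSum (k : ℝ) (p j x : ℤ) (Y : ℕ) : ℝ :=
  modeSum k p (sectorIdx j) ((-1) ^ sectorIdx j * x) Y

lemma sectorIdx_natCast (n : ℕ) : sectorIdx n = n := by simp [sectorIdx]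

lemma sectorIdx_neg (n : ℕ) : sectorIdx (-1 - n) = n := by
  rw [sectorIdx, if_neg (by omega)]; omega

lemma exists_sector_form (j : ℤ) : ∃ n : ℕ, j = n ∨ j = -1 - n := by
  rcases le_or_gt 0 j with h | h
  · exact ⟨j.toNat, Or.inl (by omega)⟩
  · exact ⟨(-1 - j).toNat, Or.inr (by omega)⟩

lemma sectorSum_of_even {n : ℕ} (hn : Even n) (k : ℝ) (p : ℤ) {j : ℤ} (hj : sectorIdx j = n)
    (x : ℤ) (Y : ℕ) : sectorSum k p j x Y = modeSum k p n x Y := by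
  rw [sectorSum, hj, hn.neg_one_pow, one_mul]

lemma sectorSum_of_odd {n : ℕ} (hn : Odd n) (k : ℝ) (p : ℤ) {j : ℤ} (hj : sectorIdx j = n)
    (x : ℤ) (Y : ℕ) : sectorSum k p j x Y = modeSum k p n (-x) Y := by
  rw [sectorSum, hj, hn.neg_one_pow, neg_one_mul]

lemma abs_sectorSum_le {k : ℝ} (hk : k ∈ Ioo (0 : ℝ) 1) (p j x : ℤ) (Y : ℕ) :
    |sectorSum k p j x Y| ≤ 1 / ellC k := abs_modeSum_le hk _ _ _ _

lemma sectorSum_axis_zero {k : ℝ} (hk : k ∈ Ioo (0 : ℝ) 1) (p j : ℤ) :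
    sectorSum k p j 0 0 = 0 := by
  rw [sectorSum, mul_zero, modeSum_axis_zero hk]

lemma sectorSum_harmonic {k : ℝ} (hk : k ∈ Ioo (0 : ℝ) 1) (p j x : ℤ) (Y : ℕ) :
    k / 4 * (sectorSum k p j (x + 1) (Y + 2) + sectorSum k p j (x - 1) (Y + 2) +
      (sectorSum k p j (x + 1) Y + sectorSum k p j (x - 1) Y)) = sectorSum k p j x (Y + 1) := by
  rcases Nat.even_or_odd (sectorIdx j) with h | h
  · simp only [sectorSum_of_even h k p rfl]
    exact modeSum_harmonic hk p _ x Y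
  · simp only [sectorSum_of_odd h k p rfl]
    rw [← modeSum_harmonic hk p _ (-x) Y, show -(x + 1) = -x - 1 by ring,
      show -(x - 1) = -x + 1 by ring]
    ring

lemma sectorSum_axis_succ {k : ℝ} (hk : k ∈ Ioo (0 : ℝ) 1) (p : ℤ) {j x : ℤ}
    (h : Even j ∧ x < 0 ∨ Odd j ∧ 0 < x) : sectorSum k p j x 0 = sectorSum k p (j + 1) x 0 := by
  obtain ⟨n, rfl | rfl⟩ := exists_sector_form j
  · have e := sectorIdx_natCast n
    have e' : sectorIdx ((n : ℤ) + 1) = n + 1 := sectorIdx_natCast (n + 1)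
    rcases h with ⟨h, hx⟩ | ⟨h, hx⟩
    · have hn : Even n := by exact_mod_cast h
      rw [sectorSum_of_even hn k p e, sectorSum_of_odd hn.add_one k p e',
        ← modeSum_axis_neg hk p n (X := -x) (by omega), neg_neg]
    · have hn : Odd n := by exact_mod_cast h
      rw [sectorSum_of_odd hn k p e, sectorSum_of_even hn.add_one k p e',
        modeSum_axis_neg hk p n (X := x) (by omega)]
  · rcases n with _ | n
    · rfl
    · have e := sectorIdx_neg (n + 1)
      have e' : sectorIdx (-1 - ((n + 1 : ℕ) : ℤ) + 1) = n := by
        rw [show -1 - ((n + 1 : ℕ) : ℤ) + 1 = -1 - n by push_cast; ring, sectorIdx_neg]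
      rcases h with ⟨h, hx⟩ | ⟨h, hx⟩
      · have hn : Even n := by
          have : Even (n : ℤ) := by rw [Int.even_iff] at h ⊢; push_cast at h; omega
          exact_mod_cast this
        rw [sectorSum_of_odd hn.add_one k p e, sectorSum_of_even hn k p e',
          ← modeSum_axis_neg hk p n (X := -x) (by omega), neg_neg]
      · have hn : Odd n := by
          have : Odd (n : ℤ) := by rw [Int.odd_iff] at h ⊢; push_cast at h; omega
          exact_mod_cast this
        rw [sectorSum_of_even hn.add_one k p e, sectorSum_of_odd hn k p e',
          modeSum_axis_neg hk p n (X := x) (by omega)]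

lemma modeSum_axis_level {k : ℝ} (hk : k ∈ Ioo (0 : ℝ) 1) (p : ℤ) (i : ℕ) {X : ℤ} (hX : 1 ≤ X) :
    k / 4 * (modeSum k p (i + 1) (X + 1) 1 + modeSum k p (i + 1) (X - 1) 1 +
      (modeSum k p i (-X + 1) 1 + modeSum k p i (-X - 1) 1)) = modeSum k p (i + 1) X 0 := by
  rw [mul_add, modeSum_harmonic_axis hk, modeSum_harmonic_axis hk, modeSum_axis_neg hk p i hX,
    modeFlux_neg hk p i hX]
  ring

lemma sectorSum_level {k : ℝ} (hk : k ∈ Ioo (0 : ℝ) 1) {p : ℤ} (hp : 1 ≤ p) {j x : ℤ}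
    (h : Even j ∧ 0 < x ∨ Odd j ∧ x < 0) :
    sectorSum k p j x 0 = (if j = 0 ∧ x = p then 1 else 0) +
      k / 4 * (sectorSum k p j (x + 1) 1 + sectorSum k p j (x - 1) 1 +
      (sectorSum k p (j - 1) (x + 1) 1 + sectorSum k p (j - 1) (x - 1) 1)) := by
  have hpos : ∀ y : ℤ, -(y + 1) = -y - 1 := fun y => by ring
  have hneg : ∀ y : ℤ, -(y - 1) = -y + 1 := fun y => by ring
  obtain ⟨n, rfl | rfl⟩ := exists_sector_form j
  · rcases n with _ | n
    · have hx : 1 ≤ x := by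
        rcases h with ⟨_, h⟩ | ⟨h, _⟩
        · omega
        · simp at h
      have e : sectorIdx ((0 : ℕ) : ℤ) = 0 := rfl
      have e' : sectorIdx (((0 : ℕ) : ℤ) - 1) = 0 := rfl
      simp only [sectorSum_of_even Even.zero k p e, sectorSum_of_even Even.zero k p e']
      have h1 := modeSum_harmonic_axis hk p 0 x
      have h2 := modeFlux_pole hk hp hx
      simp only [Nat.cast_zero, true_and]
      rw [← h2]
      linear_combination -2 * h1
    · have e := sectorIdx_natCast (n + 1)
      have e' : sectorIdx (((n + 1 : ℕ) : ℤ) - 1) = n := by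
        rw [show ((n + 1 : ℕ) : ℤ) - 1 = n by push_cast; ring, sectorIdx_natCast]
      rw [if_neg (by omega), zero_add]
      rcases h with ⟨h, hx⟩ | ⟨h, hx⟩
      · have hn1 : Even (n + 1) := by exact_mod_cast h
        have hn : Odd n := by rw [Nat.even_add_one, Nat.not_even_iff_odd] at hn1; exact hn1
        simp only [sectorSum_of_even hn1 k p e, sectorSum_of_odd hn k p e', hpos, hneg]
        rw [← modeSum_axis_level hk p n (X := x) (by omega)]
        ring
      · have hn1 : Odd (n + 1) := by exact_mod_cast h
        have hn : Even n := by rw [Nat.odd_add_one, Nat.not_odd_iff_even] at hn1; exact hn1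
        simp only [sectorSum_of_odd hn1 k p e, sectorSum_of_even hn k p e', hpos, hneg]
        rw [← modeSum_axis_level hk p n (X := -x) (by omega), neg_neg]
        ring
  · have e := sectorIdx_neg n
    have e' : sectorIdx (-1 - (n : ℤ) - 1) = n + 1 := by
      rw [← sectorIdx_neg (n + 1)]; congr 1; push_cast; ring
    rw [if_neg (by omega), zero_add]
    rcases h with ⟨h, hx⟩ | ⟨h, hx⟩
    · have hn : Odd n := by
        have : Odd (n : ℤ) := by rw [Int.even_iff] at h; rw [Int.odd_iff]; omega
        exact_mod_cast this
      simp only [sectorSum_of_odd hn k p e, sectorSum_of_even hn.add_one k p e', hpos, hneg]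
      rw [modeSum_axis_neg hk p n (X := x) (by omega),
        ← modeSum_axis_level hk p n (X := x) (by omega)]
      ring
    · have hn : Even n := by
        have : Even (n : ℤ) := by rw [Int.odd_iff] at h; rw [Int.even_iff]; omega
        exact_mod_cast this
      simp only [sectorSum_of_even hn k p e, sectorSum_of_odd hn.add_one k p e', hpos, hneg]
      have h1 := modeSum_axis_neg hk p n (X := -x) (by omega)
      rw [neg_neg] at h1
      rw [h1, ← modeSum_axis_level hk p n (X := -x) (by omega), neg_neg]
      ring

/-- The crossing number of a step over the positive real axis, where the axis itself is
counted as lying above. -/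
def crossing (a b : ℤ × ℤ) : ℤ :=
  if a.2 < 0 ∧ b.2 = 0 ∧ 0 < b.1 then 1 else if a.2 = 0 ∧ 0 < a.1 ∧ b.2 < 0 then -1 else 0

/-- The Green function with pole `(p, 0)`, refined by crossing number. -/
def greenFn (k : ℝ) (p c : ℤ) (a : ℤ × ℤ) : ℝ :=
  if 0 ≤ a.2 then sectorSum k p (-2 * c) a.1 a.2.natAbs
  else sectorSum k p (1 - 2 * c) a.1 a.2.natAbs

/-- The four diagonal steps. -/
def diagSteps : Finset (ℤ × ℤ) := {(1, 1), (1, -1), (-1, -1), (-1, 1)}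

/-- The sum of `f c' b` over the four diagonal neighbours `b` of `a`, where `c'` is the crossing
number left after the step to `b`. -/
def stepSum {M : Type*} [AddCommMonoid M] (f : ℤ → ℤ × ℤ → M) (c : ℤ) (a : ℤ × ℤ) : M :=
  ∑ d ∈ diagSteps, f (c - crossing a (a + d)) (a + d)

lemma stepSum_eq {M : Type*} [AddCommMonoid M] (f : ℤ → ℤ × ℤ → M) (c x y : ℤ) :
    stepSum f c (x, y) =
      f (c - crossing (x, y) (x + 1, y + 1)) (x + 1, y + 1) +
      (f (c - crossing (x, y) (x + 1, y - 1)) (x + 1, y - 1) +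
      (f (c - crossing (x, y) (x - 1, y - 1)) (x - 1, y - 1) +
      f (c - crossing (x, y) (x - 1, y + 1)) (x - 1, y + 1))) := by
  rw [stepSum, diagSteps, Finset.sum_insert (by decide), Finset.sum_insert (by decide),
    Finset.sum_insert (by decide), Finset.sum_singleton]
  rfl

lemma greenFn_zero {k : ℝ} (hk : k ∈ Ioo (0 : ℝ) 1) (p c : ℤ) : greenFn k p c 0 = 0 := by
  simp [greenFn, sectorSum_axis_zero hk]

lemma abs_greenFn_le {k : ℝ} (hk : k ∈ Ioo (0 : ℝ) 1) (p c : ℤ) (a : ℤ × ℤ) :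
    |greenFn k p c a| ≤ 1 / ellC k := by
  unfold greenFn
  split_ifs <;> exact abs_sectorSum_le hk _ _ _ _

lemma greenFn_eq {k : ℝ} (hk : k ∈ Ioo (0 : ℝ) 1) {p : ℤ} (hp : 1 ≤ p) (c : ℤ) {a : ℤ × ℤ}
    (ha : a ≠ 0) :
    greenFn k p c a = (if c = 0 ∧ a = (p, 0) then 1 else 0) + k / 4 * stepSum (greenFn k p) c a := by
  obtain ⟨x, y⟩ := a
  rw [stepSum_eq]
  rcases lt_trichotomy y 0 with hy | rfl | hy
  · obtain ⟨Y, rfl⟩ : ∃ Y : ℕ, y = -(Y + 1 : ℤ) := ⟨(-y - 1).toNat, by omega⟩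
    have key : ∀ x' : ℤ, greenFn k p (c - crossing (x, -(Y + 1 : ℤ)) (x', -(Y + 1 : ℤ) + 1))
        (x', -(Y + 1 : ℤ) + 1) = sectorSum k p (1 - 2 * c) x' Y := by
      intro x'
      rcases Y with _ | Y
      · rcases lt_trichotomy x' 0 with hx | rfl | hx
        · simp only [greenFn, crossing]
          simp [not_lt.2 hx.le]
          rw [sectorSum_axis_succ hk p (Or.inl ⟨⟨-c, by ring⟩, hx⟩)]
          congr 1; ring
        · simp [greenFn, crossing, sectorSum_axis_zero hk]
        · simp only [greenFn, crossing]
          simp [hx]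
          rw [sectorSum_axis_succ hk p (j := 1 - 2 * c) (Or.inr ⟨⟨-c, by ring⟩, hx⟩)]
          congr 1; ring
      · have h1 : ¬ (0 : ℤ) ≤ -(((Y + 1 : ℕ) : ℤ) + 1) + 1 := by push_cast; omega
        have h2 : crossing (x, -(((Y + 1 : ℕ) : ℤ) + 1)) (x', -(((Y + 1 : ℕ) : ℤ) + 1) + 1) = 0 := by
          simp only [crossing]
          rw [if_neg (by omega), if_neg (by omega)]
        rw [h2, greenFn, if_neg h1, sub_zero]
        congr 1
    have key2 : ∀ x' : ℤ, greenFn k p (c - crossing (x, -(Y + 1 : ℤ)) (x', -(Y + 1 : ℤ) - 1))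
        (x', -(Y + 1 : ℤ) - 1) = sectorSum k p (1 - 2 * c) x' (Y + 2) := by
      intro x'
      have h2 : crossing (x, -(Y + 1 : ℤ)) (x', -(Y + 1 : ℤ) - 1) = 0 := by
        simp only [crossing]
        rw [if_neg (by omega), if_neg (by omega)]
      rw [h2, greenFn, if_neg (by simp only []; omega), sub_zero]
      congr 1
    rw [key, key, key2, key2, if_neg (by simp only [Prod.mk.injEq]; omega), zero_add, greenFn,
      if_neg (by simp only []; omega)]
    have e : (-((Y : ℤ) + 1)).natAbs = Y + 1 := by omega
    simp only [e]
    rw [← sectorSum_harmonic hk]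
    ring
  · have hx : x ≠ 0 := fun h => ha (by rw [h]; rfl)
    have up : ∀ x' : ℤ, greenFn k p (c - crossing (x, 0) (x', 0 + 1)) (x', 0 + 1) =
        sectorSum k p (-2 * c) x' 1 := by
      intro x'; simp [greenFn, crossing]
    rcases lt_or_gt_of_ne hx with hx | hx
    · have down : ∀ x' : ℤ, greenFn k p (c - crossing (x, 0) (x', 0 - 1)) (x', 0 - 1) =
          sectorSum k p (1 - 2 * c) x' 1 := by
        intro x'; simp [greenFn, crossing, not_lt.2 hx.le]
      rw [up, up, down, down, if_neg (by simp only [Prod.mk.injEq]; omega), zero_add, greenFn,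
        if_pos le_rfl]
      simp only [Int.natAbs_zero]
      rw [sectorSum_axis_succ hk p (Or.inl ⟨⟨-c, by ring⟩, hx⟩),
        show -2 * c + 1 = 1 - 2 * c by ring,
        sectorSum_level hk hp (Or.inr ⟨⟨-c, by ring⟩, hx⟩), if_neg (by omega),
        show 1 - 2 * c - 1 = -2 * c by ring]
      ring
    · have down : ∀ x' : ℤ, greenFn k p (c - crossing (x, 0) (x', 0 - 1)) (x', 0 - 1) =
          sectorSum k p (-2 * c - 1) x' 1 := by
        intro x'
        simp [greenFn, crossing, hx]
        congr 1; ring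
      rw [up, up, down, down, greenFn, if_pos le_rfl]
      simp only [Int.natAbs_zero]
      rw [sectorSum_level hk hp (Or.inl ⟨⟨-c, by ring⟩, hx⟩)]
      have e : (-2 * c = 0 ∧ x = p) ↔ (c = 0 ∧ (x, (0 : ℤ)) = (p, 0)) := by
        simp
      simp only [e]
      ring
  · obtain ⟨Y, rfl⟩ : ∃ Y : ℕ, y = (Y + 1 : ℤ) := ⟨(y - 1).toNat, by omega⟩
    have key : ∀ (x' : ℤ) (s : ℤ) (Z : ℕ), (Y + 1 : ℤ) + s = Z → 
        greenFn k p (c - crossing (x, (Y + 1 : ℤ)) (x', Y + 1 + s)) (x', Y + 1 + s) =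
          sectorSum k p (-2 * c) x' Z := by
      intro x' s Z hZ
      have h2 : crossing (x, (Y + 1 : ℤ)) (x', Y + 1 + s) = 0 := by
        simp only [crossing]
        rw [if_neg (by omega), if_neg (by omega)]
      rw [h2, greenFn, if_pos (by simp only []; omega), sub_zero, hZ]
      rfl
    have k1 := fun x' => key x' (-1) Y (by ring)
    have k2 := fun x' => key x' 1 (Y + 2) (by push_cast; ring)
    simp only [← sub_eq_add_neg] at k1
    rw [k1, k1, k2, k2, if_neg (by simp only [Prod.mk.injEq]; omega), zero_add, greenFn,
      if_pos (by simp only []; omega)]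
    have e : ((Y : ℤ) + 1).natAbs = Y + 1 := by omega
    simp only [e]
    rw [← sectorSum_harmonic hk]
    ring

lemma isDiagStep_iff {a b : ℤ × ℤ} : IsDiagStep a b ↔ b - a ∈ diagSteps := by
  simp [IsDiagStep, diagSteps]

lemma isDiagStep_iff_abs {a b : ℤ × ℤ} :
    IsDiagStep a b ↔ |b.1 - a.1| = 1 ∧ |b.2 - a.2| = 1 := by
  simp only [IsDiagStep, Prod.ext_iff, Prod.fst_sub, Prod.snd_sub, abs_eq zero_le_one]
  omega

/-- Walks of `l` diagonal steps from `a` to `(p, 0)` that avoid the origin and have total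
crossing number `c`. -/
def walkFns (p : ℤ) : (l : ℕ) → ℤ → ℤ × ℤ → Finset (Fin (l + 1) → ℤ × ℤ)
  | 0, c, a => if c = 0 ∧ a = (p, 0) then {fun _ => a} else ∅
  | l + 1, c, a => if a = 0 then ∅ else diagSteps.biUnion fun d =>
      (walkFns p l (c - crossing a (a + d)) (a + d)).image (Fin.cons a)

lemma mem_walkFns {p : ℤ} (hp : 1 ≤ p) {l : ℕ} {c : ℤ} {a : ℤ × ℤ} {f : Fin (l + 1) → ℤ × ℤ} :
    f ∈ walkFns p l c a ↔ f 0 = a ∧ f (Fin.last l) = (p, 0) ∧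
      (∀ i : Fin l, IsDiagStep (f i.castSucc) (f i.succ)) ∧ (∀ i, f i ≠ 0) ∧
      ∑ i : Fin l, crossing (f i.castSucc) (f i.succ) = c := by
  induction l generalizing c a with
  | zero =>
    simp only [walkFns]
    have hp0 : ((p, 0) : ℤ × ℤ) ≠ 0 := by
      intro h; simp [Prod.ext_iff] at h; omega
    constructor
    · intro h
      split_ifs at h with h1
      · rw [Finset.mem_singleton] at h
        subst h
        obtain ⟨rfl, rfl⟩ := h1
        simpa using hp0
      · simp at h
    · rintro ⟨rfl, h1, -, -, h2⟩
      rw [if_pos ⟨by simpa using h2.symm, by simpa using h1⟩, Finset.mem_singleton]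
      funext i
      rw [Fin.eq_zero i]
  | succ l ih =>
    rw [walkFns]
    constructor
    · intro h
      split_ifs at h with ha
      · simp at h
      simp only [Finset.mem_biUnion, Finset.mem_image] at h
      obtain ⟨d, hd, g, hg, rfl⟩ := h
      rw [ih] at hg
      obtain ⟨g0, gl, gs, gn, gc⟩ := hg
      refine ⟨rfl, by rw [← Fin.succ_last, Fin.cons_succ, gl], ?_, ?_, ?_⟩
      · rw [Fin.forall_fin_succ]
        refine ⟨?_, fun i => ?_⟩
        · simp only [Fin.castSucc_zero, Fin.cons_zero, Fin.cons_succ, g0]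
          rw [isDiagStep_iff]; simpa using hd
        · rw [← Fin.succ_castSucc, Fin.cons_succ, Fin.cons_succ]
          exact gs i
      · rw [Fin.forall_fin_succ]
        exact ⟨ha, gn⟩
      · rw [Fin.sum_univ_succ]
        simp only [← Fin.succ_castSucc, Fin.cons_succ, gc, Fin.castSucc_zero, Fin.cons_zero, g0]
        ring
    · rintro ⟨f0, fl, fs, fn, fc⟩
      rw [if_neg (by rw [← f0]; exact fn 0)]
      simp only [Finset.mem_biUnion, Finset.mem_image]
      have h01 := fs 0
      rw [isDiagStep_iff, Fin.castSucc_zero, f0] at h01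
      refine ⟨_, h01, Fin.tail f, ?_, ?_⟩
      · rw [ih]
        refine ⟨by simp [Fin.tail], by rw [Fin.tail, Fin.succ_last, fl],
          fun i => ?_, fun i => fn _, ?_⟩
        · have := fs i.succ
          rwa [← Fin.succ_castSucc] at this
        · rw [Fin.sum_univ_succ] at fc
          simp only [← Fin.succ_castSucc, Fin.castSucc_zero, f0] at fc
          rw [add_sub_cancel, ← fc]
          simp [Fin.tail]
      · rw [← f0]; exact Fin.cons_self_tail f

lemma card_walkFns_zero (p c : ℤ) (a : ℤ × ℤ) :
    (walkFns p 0 c a).card = if c = 0 ∧ a = (p, 0) then 1 else 0 := by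
  rw [walkFns]; split_ifs <;> simp

lemma card_walkFns_succ {p : ℤ} (hp : 1 ≤ p) (l : ℕ) (c : ℤ) {a : ℤ × ℤ} (ha : a ≠ 0) :
    (walkFns p (l + 1) c a).card = stepSum (fun c a => (walkFns p l c a).card) c a := by
  rw [walkFns, if_neg ha, Finset.card_biUnion]
  · refine Finset.sum_congr rfl fun d _ => ?_
    rw [Finset.card_image_of_injective _ (Fin.cons_right_injective (α := fun _ => ℤ × ℤ) a)]
  · intro d _ d' _ hdd
    rw [Function.onFun, Finset.disjoint_left]
    intro f hf hf'
    simp only [Finset.mem_image] at hf hf'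
    obtain ⟨g, hg, rfl⟩ := hf
    obtain ⟨g', hg', h⟩ := hf'
    obtain rfl := Fin.cons_right_injective (α := fun _ => ℤ × ℤ) a h
    exact hdd (add_left_cancel (((mem_walkFns hp).1 hg).1.symm.trans ((mem_walkFns hp).1 hg').1))

lemma walkFns_origin {p : ℤ} (hp : 1 ≤ p) (l : ℕ) (c : ℤ) : walkFns p l c 0 = ∅ := by
  cases l with
  | zero => rw [walkFns, if_neg]; rintro ⟨-, h⟩; simp [Prod.ext_iff] at h; omega
  | succ l => rw [walkFns, if_pos rfl]

/-- The generating function of the walks with fewer than `L` steps. -/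
def partialWalkSum (t : ℝ) (p : ℤ) (L : ℕ) (c : ℤ) (a : ℤ × ℤ) : ℝ :=
  ∑ l ∈ Finset.range L, t ^ l * (walkFns p l c a).card

lemma partialWalkSum_succ (t : ℝ) {p : ℤ} (hp : 1 ≤ p) (L : ℕ) (c : ℤ) {a : ℤ × ℤ} (ha : a ≠ 0) :
    partialWalkSum t p (L + 1) c a =
      (if c = 0 ∧ a = (p, 0) then 1 else 0) + t * stepSum (partialWalkSum t p L) c a := by
  rw [partialWalkSum, Finset.sum_range_succ', card_walkFns_zero, add_comm]
  congr 1
  · split_ifs <;> simp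
  · simp only [stepSum, partialWalkSum]
    rw [Finset.sum_comm, Finset.mul_sum]
    refine Finset.sum_congr rfl fun l _ => ?_
    rw [card_walkFns_succ hp l c ha, stepSum, Nat.cast_sum, ← Finset.mul_sum]
    ring

lemma abs_stepSum_sub_le {f g : ℤ → ℤ × ℤ → ℝ} {B : ℝ} (h : ∀ c a, |f c a - g c a| ≤ B) (c : ℤ)
    (a : ℤ × ℤ) : |stepSum f c a - stepSum g c a| ≤ 4 * B := by
  rw [stepSum, stepSum, ← Finset.sum_sub_distrib]
  refine (Finset.abs_sum_le_sum_abs _ _).trans ((Finset.sum_le_sum fun d _ => h _ _).trans ?_)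
  rw [Finset.sum_const, show diagSteps.card = 4 from rfl]
  simp

lemma abs_greenFn_sub_partialWalkSum_le {t : ℝ} (ht : t ∈ Ioo (0 : ℝ) (1 / 4)) {p : ℤ}
    (hp : 1 ≤ p) (L : ℕ) (c : ℤ) (a : ℤ × ℤ) :
    |greenFn (4 * t) p c a - partialWalkSum t p L c a| ≤ (4 * t) ^ L * (1 / ellC (4 * t)) := by
  have hk : 4 * t ∈ Ioo (0 : ℝ) 1 := ⟨by linarith [ht.1], by linarith [ht.2]⟩
  induction L generalizing c a with
  | zero => simpa [partialWalkSum] using abs_greenFn_le hk p c a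
  | succ L ih =>
    rcases eq_or_ne a 0 with rfl | ha
    · have hC := ellC_pos hk
      have ht0 := hk.1
      rw [greenFn_zero hk]
      simp only [partialWalkSum, walkFns_origin hp]
      simp only [Finset.card_empty, Nat.cast_zero, mul_zero, Finset.sum_const_zero, sub_zero,
        abs_zero]
      positivity
    · rw [greenFn_eq hk hp c ha, partialWalkSum_succ t hp L c ha, add_sub_add_left_eq_sub,
        mul_div_cancel_left₀ t four_ne_zero, ← mul_sub, abs_mul, abs_of_pos ht.1]
      have h := mul_le_mul_of_nonneg_left (abs_stepSum_sub_le ih c a) ht.1.le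
      refine h.trans (le_of_eq ?_)
      ring

/-- The Green function is the generating function of walks refined by crossing number. -/
theorem hasSum_card_walkFns {t : ℝ} (ht : t ∈ Ioo (0 : ℝ) (1 / 4)) {p : ℤ} (hp : 1 ≤ p) (c : ℤ)
    (a : ℤ × ℤ) :
    HasSum (fun l => t ^ l * ((walkFns p l c a).card : ℝ)) (greenFn (4 * t) p c a) := by
  rw [hasSum_iff_tendsto_nat_of_nonneg fun l => mul_nonneg (pow_nonneg ht.1.le l) (Nat.cast_nonneg _)]
  rw [tendsto_iff_norm_sub_tendsto_zero]
  have h0 : Filter.Tendsto (fun L : ℕ => (4 * t) ^ L * (1 / ellC (4 * t))) Filter.atTop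
      (nhds 0) := by
    simpa using (tendsto_pow_atTop_nhds_zero_of_lt_one (by linarith [ht.1])
      (by linarith [ht.2])).mul_const (1 / ellC (4 * t))
  refine squeeze_zero (fun _ => norm_nonneg _) (fun L => ?_) h0
  rw [norm_sub_rev]
  exact abs_greenFn_sub_partialWalkSum_le ht hp L c a

lemma ptC_re (a : ℤ × ℤ) : (ptC a).re = a.1 := by simp [ptC]

lemma ptC_im (a : ℤ × ℤ) : (ptC a).im = a.2 := by simp [ptC]

lemma ptC_ne_zero {a : ℤ × ℤ} (ha : a ≠ 0) : ptC a ≠ 0 := by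
  intro h
  apply ha
  have h1 := congrArg Complex.re h
  have h2 := congrArg Complex.im h
  rw [ptC_re, Complex.zero_re] at h1
  rw [ptC_im, Complex.zero_im] at h2
  exact Prod.ext (by exact_mod_cast h1) (by exact_mod_cast h2)

/-- The argument of a lattice point in `[0, 2π)`. -/
def argNonneg (a : ℤ × ℤ) : ℝ := if 0 ≤ a.2 then (ptC a).arg else (ptC a).arg + 2 * π

lemma argNonneg_of_nonneg {a : ℤ × ℤ} (h : 0 ≤ a.2) :
    argNonneg a ∈ Icc 0 π ∧ argNonneg a = (ptC a).arg := by
  have h' : 0 ≤ (ptC a).im := by rw [ptC_im]; exact_mod_cast h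
  rw [argNonneg, if_pos h]
  exact ⟨⟨Complex.arg_nonneg_iff.2 h', Complex.arg_le_pi _⟩, rfl⟩

lemma argNonneg_of_neg {a : ℤ × ℤ} (h : a.2 < 0) : argNonneg a ∈ Ioo π (2 * π) := by
  have h' : (ptC a).im < 0 := by rw [ptC_im]; exact_mod_cast h
  rw [argNonneg, if_neg (not_le.2 h)]
  have h1 := Complex.arg_neg_iff.2 h'
  have h2 := Complex.neg_pi_lt_arg (ptC a)
  exact ⟨by linarith, by linarith⟩

lemma argNonneg_axis_pos {a : ℤ × ℤ} (h : a.2 = 0) (hx : 0 < a.1) : argNonneg a = 0 := by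
  rw [(argNonneg_of_nonneg h.ge).2, Complex.arg_eq_zero_iff, ptC_re, ptC_im, h]
  exact ⟨by exact_mod_cast hx.le, by simp⟩

lemma argNonneg_axis_neg {a : ℤ × ℤ} (h : a.2 = 0) (hx : a.1 < 0) : argNonneg a = π := by
  rw [(argNonneg_of_nonneg h.ge).2, Complex.arg_eq_pi_iff, ptC_re, ptC_im, h]
  exact ⟨by exact_mod_cast hx, by simp⟩

lemma arg_div_eq {a b : ℤ × ℤ} (ha : a ≠ 0) (hb : b ≠ 0) (j : ℤ)
    (h : argNonneg b - argNonneg a + 2 * π * j ∈ Ioc (-π) π) :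
    (ptC b / ptC a).arg = argNonneg b - argNonneg a + 2 * π * j := by
  have hA : ∀ c : ℤ × ℤ, ptC c = ‖ptC c‖ * cexp (argNonneg c * I) := by
    intro c
    rw [argNonneg]
    split_ifs
    · exact (Complex.norm_mul_exp_arg_mul_I _).symm
    · have e : (((ptC c).arg + 2 * π : ℝ) : ℂ) * I = (ptC c).arg * I + 2 * π * I := by
        push_cast; ring
      rw [e, Complex.exp_add, Complex.exp_two_pi_mul_I, mul_one]
      exact (Complex.norm_mul_exp_arg_mul_I _).symm
  have hq : ptC b / ptC a = ((‖ptC b‖ / ‖ptC a‖ : ℝ) : ℂ) *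
      cexp ((argNonneg b - argNonneg a + 2 * π * j : ℝ) * I) := by
    have e : (((argNonneg b - argNonneg a + 2 * π * j : ℝ) : ℂ)) * I =
        argNonneg b * I - argNonneg a * I + j * (2 * π * I) := by push_cast; ring
    rw [e, Complex.exp_add, Complex.exp_int_mul_two_pi_mul_I, mul_one, Complex.exp_sub]
    nth_rewrite 1 [hA b, hA a]
    push_cast
    rw [mul_div_mul_comm]
  rw [hq, Complex.arg_real_mul _ (div_pos (norm_pos_iff.2 (ptC_ne_zero hb))
    (norm_pos_iff.2 (ptC_ne_zero ha))), Complex.arg_exp_mul_I]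
  exact (toIocMod_eq_self Real.two_pi_pos).2 (by rwa [show -π + 2 * π = π by ring])

lemma arg_step {a b : ℤ × ℤ} (ha : a ≠ 0) (hb : b ≠ 0) (h : IsDiagStep a b) :
    (ptC b / ptC a).arg = argNonneg b - argNonneg a + 2 * π * crossing a b := by
  apply arg_div_eq ha hb
  rw [isDiagStep_iff_abs, abs_eq zero_le_one, abs_eq zero_le_one] at h
  have hx0 : ∀ {c : ℤ × ℤ}, c ≠ 0 → c.2 = 0 → c.1 ≠ 0 := fun hc h2 h1 => hc (Prod.ext h1 h2)
  have hpi := Real.pi_pos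
  rcases le_or_gt 0 a.2 with ya | ya <;> rcases le_or_gt 0 b.2 with yb | yb
  · obtain ⟨⟨a0, a1⟩, ea⟩ := argNonneg_of_nonneg ya
    obtain ⟨⟨b0, b1⟩, eb⟩ := argNonneg_of_nonneg yb
    have hc : crossing a b = 0 := by
      simp only [crossing]; rw [if_neg (by omega), if_neg (by omega)]
    rw [hc]
    push_cast
    refine ⟨?_, by linarith⟩
    by_contra hle
    have hb' : (ptC b).arg = 0 := by linarith
    have ha' : (ptC a).arg = π := by linarith
    rw [Complex.arg_eq_zero_iff, ptC_im] at hb'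
    rw [Complex.arg_eq_pi_iff, ptC_im] at ha'
    have h1 : b.2 = 0 := by exact_mod_cast hb'.2
    have h2 : a.2 = 0 := by exact_mod_cast ha'.2
    omega
  · have ya0 : a.2 = 0 := by omega
    obtain ⟨b0, b1⟩ := argNonneg_of_neg yb
    rcases lt_or_gt_of_ne (hx0 ha ya0) with hx | hx
    · have hc : crossing a b = 0 := by
        simp only [crossing]; rw [if_neg (by omega), if_neg (by omega)]
      rw [hc, argNonneg_axis_neg ya0 hx]
      push_cast
      exact ⟨by linarith, by linarith⟩
    · have hc : crossing a b = -1 := by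
        simp only [crossing]; rw [if_neg (by omega), if_pos (by omega)]
      rw [hc, argNonneg_axis_pos ya0 hx]
      push_cast
      exact ⟨by linarith, by linarith⟩
  · have yb0 : b.2 = 0 := by omega
    obtain ⟨a0, a1⟩ := argNonneg_of_neg ya
    rcases lt_or_gt_of_ne (hx0 hb yb0) with hx | hx
    · have hc : crossing a b = 0 := by
        simp only [crossing]; rw [if_neg (by omega), if_neg (by omega)]
      rw [hc, argNonneg_axis_neg yb0 hx]
      push_cast
      exact ⟨by linarith, by linarith⟩
    · have hc : crossing a b = 1 := by
        simp only [crossing]; rw [if_pos (by omega)]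
      rw [hc, argNonneg_axis_pos yb0 hx]
      push_cast
      exact ⟨by linarith, by linarith⟩
  · obtain ⟨a0, a1⟩ := argNonneg_of_neg ya
    obtain ⟨b0, b1⟩ := argNonneg_of_neg yb
    have hc : crossing a b = 0 := by
      simp only [crossing]; rw [if_neg (by omega), if_neg (by omega)]
    rw [hc]
    push_cast
    exact ⟨by linarith, by linarith⟩

lemma crossing_swap (a b : ℤ × ℤ) : crossing b a = -crossing a b := by
  simp only [crossing]
  split_ifs <;> first | rfl | omega

/-- Closed walks of `l + 1` diagonal steps with total crossing number `n` around the origin. -/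
def loopFns (l : ℕ) (n : ℤ) : Set (Fin (l + 1) → ℤ × ℤ) :=
  {f | (∀ i, IsDiagStep (f i) (f (i + 1))) ∧ (∀ i, f i ≠ 0) ∧
    ∑ i, crossing (f i) (f (i + 1)) = n}

/-- The list of points of a closed walk, the starting point being repeated at the end. -/
def loopList {l : ℕ} (f : Fin (l + 1) → ℤ × ℤ) : List (ℤ × ℤ) :=
  List.ofFn (Fin.snoc (α := fun _ => ℤ × ℤ) f (f 0))

lemma length_loopList {l : ℕ} (f : Fin (l + 1) → ℤ × ℤ) : (loopList f).length = l + 2 := by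
  simp [loopList]

lemma snoc_succ {l : ℕ} (f : Fin (l + 1) → ℤ × ℤ) (i : Fin (l + 1)) :
    Fin.snoc (α := fun _ => ℤ × ℤ) f (f 0) i.succ = f (i + 1) := by
  induction i using Fin.lastCases with
  | last => rw [Fin.succ_last, Fin.snoc_last, Fin.last_add_one]
  | cast i => rw [Fin.succ_castSucc, Fin.snoc_castSucc, Fin.coeSucc_eq_succ]

lemma forall_mem_loopList {l : ℕ} (f : Fin (l + 1) → ℤ × ℤ) (P : ℤ × ℤ → Prop) :
    (∀ x ∈ loopList f, P x) ↔ ∀ i, P (f i) := by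
  rw [loopList, List.forall_mem_ofFn_iff, Fin.forall_fin_succ']
  simp only [Fin.snoc_castSucc, Fin.snoc_last, and_iff_left_iff_imp]
  exact fun h => h 0

lemma wind_loopList {l : ℕ} (f : Fin (l + 1) → ℤ × ℤ) :
    wind (loopList f) = ∑ i, (ptC (f (i + 1)) / ptC (f i)).arg := by
  rw [wind, windTo, length_loopList, Nat.add_sub_assoc (by norm_num), Finset.sum_range]
  refine Finset.sum_congr rfl fun i _ => ?_
  have e : ∀ j : Fin (l + 2), (loopList f).getD j 0 =
      Fin.snoc (α := fun _ => ℤ × ℤ) f (f 0) j := fun j => by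
    rw [loopList, List.getD_eq_getElem _ _ (by rw [List.length_ofFn]; exact j.2),
      List.getElem_ofFn]
  have e1 := e (Fin.succ i)
  have e2 := e (Fin.castSucc i)
  rw [snoc_succ] at e1
  rw [Fin.snoc_castSucc] at e2
  rw [← e1, ← e2]
  rfl

lemma isWalkList_loopList {l : ℕ} {f : Fin (l + 1) → ℤ × ℤ} :
    IsWalkList (loopList f) ↔ ∀ i, IsDiagStep (f i) (f (i + 1)) := by
  rw [IsWalkList, and_iff_right (by rw [← List.length_pos_iff, length_loopList]; omega)]
  change List.IsChain _ _ ↔ _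
  rw [loopList, List.isChain_ofFn]
  have e : ∀ (i : ℕ) (hi : i + 1 < l + 1 + 1),
      IsDiagStep (Fin.snoc (α := fun _ => ℤ × ℤ) f (f 0) ⟨i, Nat.lt_of_succ_lt hi⟩)
        (Fin.snoc (α := fun _ => ℤ × ℤ) f (f 0) ⟨i + 1, hi⟩) ↔
      IsDiagStep (f ⟨i, Nat.lt_of_succ_lt_succ hi⟩) (f (⟨i, Nat.lt_of_succ_lt_succ hi⟩ + 1)) := by
    intro i hi
    rw [← snoc_succ f ⟨i, Nat.lt_of_succ_lt_succ hi⟩]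
    rw [← Fin.snoc_castSucc (α := fun _ => ℤ × ℤ) (f 0) f
      ⟨i, Nat.lt_of_succ_lt_succ hi⟩]
    rfl
  exact ⟨fun h i => (e i (Nat.succ_lt_succ i.2)).1 (h i _), fun h i hi => (e i hi).2 (h _)⟩

lemma head?_loopList {l : ℕ} (f : Fin (l + 1) → ℤ × ℤ) :
    (loopList f).head? = (loopList f).getLast? := by
  rw [List.head?_eq_getElem?, List.getLast?_eq_getElem?, length_loopList, loopList,
    List.getElem?_ofFn, List.getElem?_ofFn, dif_pos (by omega), dif_pos (by omega)]
  congr 1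
  change Fin.snoc (α := fun _ => ℤ × ℤ) f (f 0) (Fin.castSucc 0) =
    Fin.snoc (α := fun _ => ℤ × ℤ) f (f 0) (Fin.last (l + 1))
  rw [Fin.snoc_castSucc, Fin.snoc_last]

lemma isLoop_loopList {l : ℕ} {n : ℤ} {f : Fin (l + 1) → ℤ × ℤ} :
    IsLoop n (loopList f) ↔ f ∈ loopFns l n := by
  rw [IsLoop, isWalkList_loopList, forall_mem_loopList, and_iff_right (head?_loopList f),
    wind_loopList, loopFns]
  refine and_congr_right fun hs => and_congr_right fun hn => ?_
  have hrot : ∑ i, argNonneg (f (i + 1)) = ∑ i, argNonneg (f i) :=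
    Equiv.sum_comp (Equiv.addRight (1 : Fin (l + 1))) (fun i => argNonneg (f i))
  have e : ∑ i, (ptC (f (i + 1)) / ptC (f i)).arg =
      2 * π * ((∑ i, crossing (f i) (f (i + 1)) : ℤ) : ℝ) := by
    rw [Finset.sum_congr rfl fun i _ => arg_step (hn i) (hn (i + 1)) (hs i),
      Finset.sum_add_distrib, Finset.sum_sub_distrib, hrot, sub_self, zero_add,
      ← Finset.mul_sum]
    push_cast
    rfl
  rw [e, mul_right_inj' Real.two_pi_pos.ne']
  exact_mod_cast Iff.rfl

/-- The closed walks of index `n` all of whose points have coordinate sum congruent to `e`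
modulo `2`. -/
def parityLoopFns (l : ℕ) (n e : ℤ) : Set (Fin (l + 1) → ℤ × ℤ) :=
  {f | f ∈ loopFns l n ∧ ∀ i, ((f i).1 + (f i).2) % 2 = e}

lemma exists_loopList_eq {n : ℤ} (hn : n ≠ 0) {w : List (ℤ × ℤ)} (hw : IsLoop n w) :
    ∃ (l : ℕ) (f : Fin (l + 1) → ℤ × ℤ), loopList f = w := by
  obtain ⟨⟨h0, -⟩, -, h2, h3⟩ := hw
  rcases Nat.exists_eq_add_of_le' (List.length_pos_iff.2 h0) with ⟨L, hL⟩
  rcases L with _ | l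
  · rw [wind, windTo, hL] at h3
    simp [hn, Real.pi_ne_zero] at h3
  · refine ⟨l, fun i => w[(i : ℕ)]'(by omega), ?_⟩
    refine List.ext_getElem (by rw [length_loopList, hL]) fun i hi hi' => ?_
    rw [length_loopList] at hi
    simp only [loopList, List.getElem_ofFn]
    rcases Nat.lt_or_ge i (l + 1) with h | h
    · exact Fin.snoc_castSucc (α := fun _ => ℤ × ℤ) _ _ (⟨i, h⟩ : Fin (l + 1))
    · obtain rfl : i = l + 1 := by omega
      refine (Fin.snoc_last (α := fun _ => ℤ × ℤ) _ _).trans ?_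
      rw [List.head?_eq_getElem?, List.getLast?_eq_getElem?, hL,
        List.getElem?_eq_getElem (by omega), List.getElem?_eq_getElem (by omega)] at h2
      exact Option.some_injective _ h2

/-- Loops of nonzero index and given parity are cyclically indexed closed walks. -/
def loopEquiv {n : ℤ} (hn : n ≠ 0) (e : ℤ) :
    (Σ l : ℕ, parityLoopFns l n e) ≃
      {w : List (ℤ × ℤ) // IsLoop n w ∧ ∀ x ∈ w, (x.1 + x.2) % 2 = e} :=
  Equiv.ofBijective (fun f => ⟨loopList f.2.1, isLoop_loopList.2 f.2.2.1,
    (forall_mem_loopList _ fun x => (x.1 + x.2) % 2 = e).2 f.2.2.2⟩) (by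
    constructor
    · rintro ⟨l, f, hf⟩ ⟨l', f', hf'⟩ h
      have h' : loopList f = loopList f' := congrArg Subtype.val h
      have hl := congrArg List.length h'
      rw [length_loopList, length_loopList] at hl
      obtain rfl : l = l' := by omega
      have := List.ofFn_injective h'
      obtain rfl : f = f' := by
        funext i
        have := congrFun this i.castSucc
        rwa [Fin.snoc_castSucc, Fin.snoc_castSucc] at this
      rfl
    · rintro ⟨w, hw, hp⟩
      obtain ⟨l, f, rfl⟩ := exists_loopList_eq hn hw
      exact ⟨⟨l, f, isLoop_loopList.1 hw,
        (forall_mem_loopList _ fun x => (x.1 + x.2) % 2 = e).1 hp⟩, rfl⟩)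

lemma length_loopEquiv {n : ℤ} (hn : n ≠ 0) (e : ℤ) (f : Σ l : ℕ, parityLoopFns l n e) :
    (loopEquiv hn e f).val.length - 1 = f.1 + 1 := by
  change (loopList f.2.1).length - 1 = _
  rw [length_loopList]
  rfl

open scoped ENNReal

/-- The number of elements of a set, as an extended nonnegative real. -/
def setCount {α : Type*} (s : Set α) : ℝ≥0∞ := ∑' x, s.indicator 1 x

lemma setCount_preimage {α β : Type*} (g : α ≃ β) (s : Set β) :
    setCount (g ⁻¹' s) = setCount s := by
  rw [setCount, setCount, ← g.tsum_eq]
  rfl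

lemma setCount_coe_finset {α : Type*} (s : Finset α) : setCount (s : Set α) = s.card := by
  rw [setCount, tsum_eq_sum (s := s) fun b hb => Set.indicator_of_notMem (by simpa using hb) _,
    Finset.sum_congr rfl fun b hb => Set.indicator_of_mem (by simpa using hb) _]
  simp

lemma crossing_mem (a b : ℤ × ℤ) : crossing a b = 0 ∨ crossing a b = 1 ∨ crossing a b = -1 := by
  simp only [crossing]
  split_ifs <;> simp

/-- Closed walks of index `n` and parity `e` whose `i`-th step has crossing number `ε`. -/
def stepLoopFns (l : ℕ) (n e : ℤ) (i : Fin (l + 1)) (ε : ℤ) : Set (Fin (l + 1) → ℤ × ℤ) :=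
  {f | f ∈ parityLoopFns l n e ∧ crossing (f i) (f (i + 1)) = ε}

/-- Rotation of cyclic sequences. -/
def rotateFn (l : ℕ) (j : Fin (l + 1)) : (Fin (l + 1) → ℤ × ℤ) ≃ (Fin (l + 1) → ℤ × ℤ) :=
  (Equiv.addRight (-j)).arrowCongr (Equiv.refl _)

lemma rotateFn_apply {l : ℕ} (j : Fin (l + 1)) (f : Fin (l + 1) → ℤ × ℤ) (i : Fin (l + 1)) :
    rotateFn l j f i = f (i + j) := by
  simp [rotateFn, Equiv.arrowCongr]

/-- Reversal of cyclic sequences. -/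
def reverseFn (l : ℕ) : (Fin (l + 1) → ℤ × ℤ) ≃ (Fin (l + 1) → ℤ × ℤ) :=
  (Equiv.neg (Fin (l + 1))).arrowCongr (Equiv.refl _)

lemma reverseFn_apply {l : ℕ} (f : Fin (l + 1) → ℤ × ℤ) (i : Fin (l + 1)) :
    reverseFn l f i = f (-i) := by
  simp [reverseFn, Equiv.arrowCongr]

lemma IsDiagStep.symm {a b : ℤ × ℤ} (h : IsDiagStep a b) : IsDiagStep b a := by
  rw [isDiagStep_iff_abs, abs_sub_comm, abs_sub_comm b.2] at h
  exact isDiagStep_iff_abs.2 h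

lemma mem_parityLoopFns_rotate {l : ℕ} {n e : ℤ} (j : Fin (l + 1)) {f : Fin (l + 1) → ℤ × ℤ}
    (hf : f ∈ parityLoopFns l n e) : rotateFn l j f ∈ parityLoopFns l n e := by
  obtain ⟨⟨h1, h2, h3⟩, h4⟩ := hf
  refine ⟨⟨fun i => ?_, fun i => ?_, ?_⟩, fun i => ?_⟩
  · rw [rotateFn_apply, rotateFn_apply, add_right_comm]
    exact h1 _
  · rw [rotateFn_apply]
    exact h2 _
  · rw [← h3]
    refine Fintype.sum_equiv (Equiv.addRight j) _ _ fun i => ?_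
    rw [rotateFn_apply, rotateFn_apply, add_right_comm]
    rfl
  · rw [rotateFn_apply]
    exact h4 _

lemma mem_parityLoopFns_reverse {l : ℕ} {n e : ℤ} {f : Fin (l + 1) → ℤ × ℤ}
    (hf : f ∈ parityLoopFns l n e) : reverseFn l f ∈ parityLoopFns l (-n) e := by
  obtain ⟨⟨h1, h2, h3⟩, h4⟩ := hf
  have hs : ∀ i : Fin (l + 1), -i = -(i + 1) + 1 := fun i => by abel
  refine ⟨⟨fun i => ?_, fun i => ?_, ?_⟩, fun i => ?_⟩
  · rw [reverseFn_apply, reverseFn_apply, hs i]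
    exact (h1 _).symm
  · rw [reverseFn_apply]
    exact h2 _
  · rw [← h3, ← Finset.sum_neg_distrib]
    refine Fintype.sum_equiv ((Equiv.addRight 1).trans (Equiv.neg _)) _ _ fun i => ?_
    rw [reverseFn_apply, reverseFn_apply, ← crossing_swap, hs i]
    rfl
  · rw [reverseFn_apply]
    exact h4 _

lemma reverseFn_reverseFn {l : ℕ} (f : Fin (l + 1) → ℤ × ℤ) : reverseFn l (reverseFn l f) = f := by
  funext i
  rw [reverseFn_apply, reverseFn_apply, neg_neg]

lemma rotateFn_neg_rotateFn {l : ℕ} (j : Fin (l + 1)) (f : Fin (l + 1) → ℤ × ℤ) :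
    rotateFn l (-j) (rotateFn l j f) = f := by
  funext i
  rw [rotateFn_apply, rotateFn_apply, neg_add_cancel_right]

lemma mem_parityLoopFns_rotate_iff {l : ℕ} {n e : ℤ} {j : Fin (l + 1)} {f : Fin (l + 1) → ℤ × ℤ} :
    rotateFn l j f ∈ parityLoopFns l n e ↔ f ∈ parityLoopFns l n e :=
  ⟨fun h => rotateFn_neg_rotateFn j f ▸ mem_parityLoopFns_rotate (-j) h,
    mem_parityLoopFns_rotate j⟩

lemma mem_parityLoopFns_reverse_iff {l : ℕ} {n e : ℤ} {f : Fin (l + 1) → ℤ × ℤ} :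
    reverseFn l f ∈ parityLoopFns l (-n) e ↔ f ∈ parityLoopFns l n e :=
  ⟨fun h => by
    have h' := mem_parityLoopFns_reverse h
    rwa [reverseFn_reverseFn, neg_neg] at h', mem_parityLoopFns_reverse⟩

lemma setCount_parityLoopFns_neg (l : ℕ) (n e : ℤ) :
    setCount (parityLoopFns l (-n) e) = setCount (parityLoopFns l n e) := by
  rw [← setCount_preimage (reverseFn l)]
  congr 1
  ext f
  exact mem_parityLoopFns_reverse_iff

lemma setCount_stepLoopFns (l : ℕ) (n e : ℤ) (i j : Fin (l + 1)) (ε : ℤ) :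
    setCount (stepLoopFns l n e i ε) = setCount (stepLoopFns l n e j ε) := by
  rw [← setCount_preimage (rotateFn l (j - i))]
  congr 1
  ext f
  refine and_congr mem_parityLoopFns_rotate_iff ?_
  rw [rotateFn_apply, rotateFn_apply, add_right_comm, add_sub_cancel]

lemma setCount_stepLoopFns_neg (l : ℕ) (n e : ℤ) (i : Fin (l + 1)) (ε : ℤ) :
    setCount (stepLoopFns l (-n) e i (-ε)) = setCount (stepLoopFns l n e i ε) := by
  rw [setCount_stepLoopFns l n e i (-(i + 1)), ← setCount_preimage (reverseFn l)]
  congr 1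
  ext f
  refine and_congr mem_parityLoopFns_reverse_iff ?_
  rw [reverseFn_apply, reverseFn_apply, crossing_swap, neg_inj, show -i = -(i + 1) + 1 by abel]

lemma natCast_mul_setCount_parityLoopFns (l N : ℕ) (e : ℤ) :
    (l + 1) * setCount (stepLoopFns l (-N) e (Fin.last l) (-1)) =
      N * setCount (parityLoopFns l N e) +
        (l + 1) * setCount (stepLoopFns l N e (Fin.last l) (-1)) := by
  rw [setCount_stepLoopFns_neg]
  have h : ∀ ε : ℤ, (l + 1) * setCount (stepLoopFns l N e (Fin.last l) ε) =
      ∑' f, ∑ i, (stepLoopFns l N e i ε).indicator (1 : (Fin (l + 1) → ℤ × ℤ) → ℝ≥0∞) f := by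
    intro ε
    rw [Summable.tsum_finsetSum fun _ _ => ENNReal.summable]
    change _ = ∑ i, setCount (stepLoopFns l N e i ε)
    rw [Finset.sum_congr rfl fun i _ => setCount_stepLoopFns l N e i (Fin.last l) ε]
    simp
  rw [h, h, setCount, ← ENNReal.tsum_mul_left, ← ENNReal.tsum_add]
  refine tsum_congr fun f => ?_
  by_cases hf : f ∈ parityLoopFns l N e
  · have hi : ∀ (i : Fin (l + 1)) (ε : ℤ), (stepLoopFns l N e i ε).indicator (1 : (Fin (l + 1) → ℤ × ℤ) → ℝ≥0∞) f =
        ((if crossing (f i) (f (i + 1)) = ε then 1 else 0 : ℕ) : ℝ≥0∞) := by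
      intro i ε
      split_ifs with h1
      · rw [Set.indicator_of_mem (show f ∈ stepLoopFns l N e i ε from ⟨hf, h1⟩)]
        simp
      · rw [Set.indicator_of_notMem fun h2 : f ∈ stepLoopFns l N e i ε => h1 h2.2]
        simp
    simp only [hi, Set.indicator_of_mem hf, Pi.one_apply, mul_one]
    norm_cast
    have h3 := hf.1.2.2
    zify
    rw [← h3, ← Finset.sum_add_distrib]
    refine Finset.sum_congr rfl fun i _ => ?_
    rcases crossing_mem (f i) (f (i + 1)) with h4 | h4 | h4 <;> simp [h4]
  · have hi : ∀ (i : Fin (l + 1)) (ε : ℤ),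
        (stepLoopFns l N e i ε).indicator (1 : (Fin (l + 1) → ℤ × ℤ) → ℝ≥0∞) f = 0 :=
      fun i ε => Set.indicator_of_notMem (fun h2 => hf h2.1) _
    simp [hi, Set.indicator_of_notMem hf]

lemma parity_eq_of_mem_loopFns {l : ℕ} {n : ℤ} {f : Fin (l + 1) → ℤ × ℤ} (hf : f ∈ loopFns l n)
    (i : Fin (l + 1)) : ((f i).1 + (f i).2) % 2 = ((f 0).1 + (f 0).2) % 2 := by
  induction i using Fin.induction with
  | zero => rfl
  | succ i ih =>
    have h := hf.1 i.castSucc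
    rw [Fin.coeSucc_eq_succ, isDiagStep_iff_abs, abs_eq zero_le_one, abs_eq zero_le_one] at h
    omega

lemma mem_walkFns_iff_mem_loopFns {p : ℤ} (hp : 1 ≤ p) {l : ℕ} {n : ℤ} {a : ℤ × ℤ}
    (ha : IsDiagStep (p, 0) a) (ha2 : a.2 = -1) {f : Fin (l + 1) → ℤ × ℤ} :
    f ∈ walkFns p l (n + 1) a ↔ f ∈ loopFns l n ∧ f (Fin.last l) = (p, 0) ∧ f 0 = a := by
  have hc : crossing (p, 0) a = -1 := by
    simp only [crossing, ha2]
    rw [if_neg (by omega), if_pos ⟨trivial, by omega, by omega⟩]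
  rw [mem_walkFns hp, loopFns, Set.mem_ofPred_eq, Fin.sum_univ_castSucc,
    Fin.forall_fin_succ' (P := fun i => IsDiagStep (f i) (f (i + 1)))]
  simp only [Fin.coeSucc_eq_succ, Fin.last_add_one]
  constructor
  · rintro ⟨h0, hl, hs, hn, hsum⟩
    rw [h0, hl]
    refine ⟨⟨⟨hs, ?_⟩, hn, by rw [hsum, hc]; ring⟩, rfl, rfl⟩
    exact ha
  · rintro ⟨⟨⟨hs, -⟩, hn, hsum⟩, hl, h0⟩
    rw [h0, hl, hc] at hsum
    exact ⟨h0, hl, hs, hn, by linarith⟩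

lemma crossing_eq_neg_one_iff {a b : ℤ × ℤ} (h : IsDiagStep a b) :
    crossing a b = -1 ↔ a.2 = 0 ∧ 1 ≤ a.1 ∧ (b = (a.1 + 1, -1) ∨ b = (a.1 - 1, -1)) := by
  rw [isDiagStep_iff_abs, abs_eq zero_le_one, abs_eq zero_le_one] at h
  simp only [crossing, Prod.ext_iff]
  split_ifs <;> constructor <;> intro h' <;> first | omega | exact h'.elim

/-- The walks obtained by deleting the last step of a closed walk, when that step crosses the
positive axis downwards from `(p, 0)`. -/
def crossingWalks (e : ℤ) (p l : ℕ) (n : ℤ) : ℝ≥0∞ :=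
  if 1 ≤ p ∧ (p : ℤ) % 2 = e then
    ((walkFns p l (n + 1) (p + 1, -1)).card : ℝ≥0∞) + (walkFns p l (n + 1) (p - 1, -1)).card
  else 0

lemma setCount_stepLoopFns_last (l : ℕ) (n e : ℤ) :
    setCount (stepLoopFns l n e (Fin.last l) (-1)) = ∑' p : ℕ, crossingWalks e p l n := by
  have hcr : ∀ p : ℕ, crossingWalks e p l n =
      ∑' f, if 1 ≤ p ∧ (p : ℤ) % 2 = e then
        ((walkFns p l (n + 1) (p + 1, -1) : Set (Fin (l + 1) → ℤ × ℤ))).indicator 1 f +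
        ((walkFns p l (n + 1) (p - 1, -1) : Set (Fin (l + 1) → ℤ × ℤ))).indicator 1 f
        else 0 := by
    intro p
    rw [crossingWalks]
    split_ifs
    · rw [ENNReal.tsum_add, ← setCount_coe_finset, ← setCount_coe_finset]
      rfl
    · simp
  have hst : ∀ p : ℕ, IsDiagStep ((p : ℤ), 0) (p + 1, -1) ∧ IsDiagStep ((p : ℤ), 0) (p - 1, -1) :=
    fun p => by simp [isDiagStep_iff_abs]
  simp only [hcr]
  rw [ENNReal.tsum_comm, setCount]
  refine tsum_congr fun f => ?_
  by_cases hf : f ∈ stepLoopFns l n e (Fin.last l) (-1)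
  · rw [Set.indicator_of_mem hf]
    obtain ⟨⟨h1, h2⟩, h3⟩ := hf
    rw [crossing_eq_neg_one_iff (h1.1 _), Fin.last_add_one] at h3
    obtain ⟨h4, h5, h6⟩ := h3
    have h7 : f (Fin.last l) = (((f (Fin.last l)).1.toNat : ℤ), 0) :=
      Prod.ext (Int.toNat_of_nonneg (by omega)).symm h4
    have h8 : (f (Fin.last l)).1 = (f (Fin.last l)).1.toNat :=
      (Int.toNat_of_nonneg (by omega)).symm
    set p := (f (Fin.last l)).1.toNat with hp
    have h9 := h2 (Fin.last l)
    have hp1 : (1 : ℤ) ≤ p := by omega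
    rw [tsum_eq_single p, if_pos ⟨by omega, by omega⟩]
    · have hw1 := mem_walkFns_iff_mem_loopFns (n := n) hp1 (hst p).1 rfl (f := f)
      have hw2 := mem_walkFns_iff_mem_loopFns (n := n) hp1 (hst p).2 rfl (f := f)
      rw [h8] at h6
      rcases h6 with h6 | h6
      · rw [Set.indicator_of_mem (hw1.2 ⟨h1, h7, h6⟩), Set.indicator_of_notMem, add_zero]
        · intro h
          have h10 := (hw2.1 h).2.2
          rw [h6, Prod.ext_iff] at h10
          simp only at h10
          omega
      · rw [Set.indicator_of_mem (hw2.2 ⟨h1, h7, h6⟩), Set.indicator_of_notMem, zero_add]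
        · intro h
          have h10 := (hw1.1 h).2.2
          rw [h6, Prod.ext_iff] at h10
          simp only at h10
          omega
    · intro p' hp'
      split_ifs with h10
      · have h11 : (1 : ℤ) ≤ p' := by omega
        have hw1 := mem_walkFns_iff_mem_loopFns (n := n) h11 (hst p').1 rfl (f := f)
        have hw2 := mem_walkFns_iff_mem_loopFns (n := n) h11 (hst p').2 rfl (f := f)
        have h12 : f (Fin.last l) ≠ ((p' : ℤ), 0) := by
          rw [h7]
          intro h
          rw [Prod.ext_iff] at h
          simp only at h
          omega
        rw [Set.indicator_of_notMem fun h => h12 (hw1.1 h).2.1,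
          Set.indicator_of_notMem fun h => h12 (hw2.1 h).2.1, add_zero]
      · rfl
  · rw [Set.indicator_of_notMem hf]
    refine (ENNReal.tsum_eq_zero.2 fun p => ?_).symm
    split_ifs with h10
    · have hp1 : (1 : ℤ) ≤ p := by omega
      have key : ∀ a : ℤ × ℤ, a = ((p : ℤ) + 1, -1) ∨ a = ((p : ℤ) - 1, -1) →
          IsDiagStep ((p : ℤ), 0) a → a.2 = -1 → f ∉ walkFns p l (n + 1) a := by
        intro a ha hs ha2 h
        rw [mem_walkFns_iff_mem_loopFns hp1 hs ha2] at h
        obtain ⟨h1, h2, h3⟩ := h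
        refine hf ⟨⟨h1, fun i => ?_⟩, ?_⟩
        · have h4 := parity_eq_of_mem_loopFns h1 (Fin.last l)
          rw [parity_eq_of_mem_loopFns h1 i, ← h4, h2]
          simpa using h10.2
        · rw [Fin.last_add_one, h2, h3, crossing_eq_neg_one_iff hs]
          exact ⟨rfl, hp1, ha⟩
      rw [Set.indicator_of_notMem, Set.indicator_of_notMem, add_zero]
      · exact key _ (Or.inr rfl) (hst p).2 rfl
      · exact key _ (Or.inl rfl) (hst p).1 rfl
    · rfl

/-- The generating function of rooted loops of index `n` and parity `e`, weighted by inverse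
length. -/
def loopSum (t : ℝ) (n e : ℤ) : ℝ≥0∞ :=
  ∑' l : ℕ, ENNReal.ofReal t ^ (l + 1) / (l + 1) * setCount (parityLoopFns l n e)

/-- The generating function of rooted loops of index `n` and parity `e` whose last step crosses
the positive axis downwards. -/
def crossSum (t : ℝ) (n e : ℤ) : ℝ≥0∞ :=
  ∑' l : ℕ, ENNReal.ofReal t ^ (l + 1) * setCount (stepLoopFns l n e (Fin.last l) (-1))

lemma loopSum_neg (t : ℝ) (n e : ℤ) : loopSum t (-n) e = loopSum t n e := by
  simp only [loopSum, setCount_parityLoopFns_neg]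

lemma crossSum_neg (t : ℝ) (N : ℕ) (e : ℤ) :
    crossSum t (-N) e = N * loopSum t N e + crossSum t N e := by
  rw [crossSum, crossSum, loopSum, ← ENNReal.tsum_mul_left, ← ENNReal.tsum_add]
  refine tsum_congr fun l => ?_
  have h0 : (l + 1 : ℝ≥0∞) ≠ 0 := by simp
  have h1 : (l + 1 : ℝ≥0∞) ≠ ∞ := by finiteness
  have h := natCast_mul_setCount_parityLoopFns l N e
  have hd : ∀ x : ℝ≥0∞, ENNReal.ofReal t ^ (l + 1) * x =
      ENNReal.ofReal t ^ (l + 1) / (l + 1) * ((l + 1) * x) := by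
    intro x
    rw [← mul_assoc, ENNReal.div_mul_cancel h0 h1]
  rw [hd, h, mul_add, ← hd]
  ring

lemma greenFn_nonneg {t : ℝ} (ht : t ∈ Ioo (0 : ℝ) (1 / 4)) {p : ℤ} (hp : 1 ≤ p) (c : ℤ)
    (a : ℤ × ℤ) : 0 ≤ greenFn (4 * t) p c a :=
  (hasSum_card_walkFns ht hp c a).nonneg fun l =>
    mul_nonneg (pow_nonneg ht.1.le l) (Nat.cast_nonneg _)

/-- The Green function summed over the endpoints of the downward steps from `(p, 0)`. -/
def crossGreen (t : ℝ) (p n : ℤ) : ℝ :=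
  t * (greenFn (4 * t) p (n + 1) (p + 1, -1) + greenFn (4 * t) p (n + 1) (p - 1, -1))

lemma crossGreen_nonneg {t : ℝ} (ht : t ∈ Ioo (0 : ℝ) (1 / 4)) {p : ℤ} (hp : 1 ≤ p) (n : ℤ) :
    0 ≤ crossGreen t p n :=
  mul_nonneg ht.1.le (add_nonneg (greenFn_nonneg ht hp _ _) (greenFn_nonneg ht hp _ _))

lemma crossSum_eq {t : ℝ} (ht : t ∈ Ioo (0 : ℝ) (1 / 4)) (n e : ℤ) :
    crossSum t n e =
      ∑' p : ℕ, if 1 ≤ p ∧ (p : ℤ) % 2 = e then ENNReal.ofReal (crossGreen t p n) else 0 := by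
  simp only [crossSum, setCount_stepLoopFns_last, ← ENNReal.tsum_mul_left]
  rw [ENNReal.tsum_comm]
  refine tsum_congr fun p => ?_
  simp only [crossingWalks]
  split_ifs with hp
  · have hp1 : (1 : ℤ) ≤ p := by omega
    have h := ((hasSum_card_walkFns ht hp1 (n + 1) (p + 1, -1)).add
      (hasSum_card_walkFns ht hp1 (n + 1) (p - 1, -1))).mul_left t
    rw [crossGreen, ← h.tsum_eq, ENNReal.ofReal_tsum_of_nonneg _ h.summable]
    · refine tsum_congr fun l => ?_
      have ht0 := ht.1.le
      rw [← mul_add, ← mul_assoc, ← pow_succ', ENNReal.ofReal_mul (by positivity),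
        ENNReal.ofReal_pow ht0, ENNReal.ofReal_add (by positivity) (by positivity),
        ENNReal.ofReal_natCast, ENNReal.ofReal_natCast]
    · intro l
      have ht0 := ht.1.le
      positivity
  · simp

lemma crossGreen_natCast {t : ℝ} (ht : t ∈ Ioo (0 : ℝ) (1 / 4)) (N : ℕ) (p : ℤ) :
    crossGreen t p N = (modeSum (4 * t) p (2 * N) p 0 -
      ellC (4 * t) * modeFlux (4 * t) p (2 * N) p) / 2 := by
  have hk : 4 * t ∈ Ioo (0 : ℝ) 1 := ⟨by linarith [ht.1], by linarith [ht.2]⟩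
  have h : sectorIdx (1 - 2 * ((N : ℤ) + 1)) = 2 * N := by
    rw [← sectorIdx_neg (2 * N)]
    congr 1
    push_cast
    ring
  rw [← modeSum_harmonic_axis hk, crossGreen, greenFn, greenFn, if_neg (by norm_num),
    if_neg (by norm_num), sectorSum_of_even (even_two_mul N) _ _ h,
    sectorSum_of_even (even_two_mul N) _ _ h, mul_div_cancel_left₀ t four_ne_zero]
  rfl

lemma crossGreen_neg_natCast {t : ℝ} (ht : t ∈ Ioo (0 : ℝ) (1 / 4)) {N : ℕ} (hN : N ≠ 0) {p : ℤ}
    (hp : 1 ≤ p) :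
    crossGreen t p (-N) = (modeSum (4 * t) p (2 * N) p 0 +
      ellC (4 * t) * modeFlux (4 * t) p (2 * N) p) / 2 := by
  have hk : 4 * t ∈ Ioo (0 : ℝ) 1 := ⟨by linarith [ht.1], by linarith [ht.2]⟩
  obtain ⟨M, rfl⟩ := Nat.exists_eq_succ_of_ne_zero hN
  have h : sectorIdx (1 - 2 * (-((M.succ : ℕ) : ℤ) + 1)) = 2 * M + 1 := by
    rw [← sectorIdx_natCast (2 * M + 1)]
    congr 1
    push_cast
    ring
  have hodd : Odd (2 * M + 1) := ⟨M, rfl⟩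
  have hax := modeSum_harmonic_axis hk p (2 * M + 1) (-p)
  rw [modeSum_axis_neg hk p _ hp, modeFlux_neg hk p _ hp, mul_neg, sub_neg_eq_add] at hax
  rw [show 2 * M.succ = 2 * M + 1 + 1 by omega, ← hax, crossGreen, greenFn, greenFn,
    if_neg (by norm_num), if_neg (by norm_num), sectorSum_of_odd hodd _ _ h,
    sectorSum_of_odd hodd _ _ h, mul_div_cancel_left₀ t four_ne_zero, neg_add, neg_sub, add_comm]
  rw [show (1 : ℤ) - p = -p + 1 by ring]
  rfl

lemma summable_modeFlux {k : ℝ} (hk : k ∈ Ioo (0 : ℝ) 1) (p : ℤ) (i : ℕ) (X : ℤ) :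
    Summable fun m : ℕ => modeWeight k p m * (qNome k ^ m) ^ i * coefA k m X := by
  have hC := (ellC_pos hk).ne'
  have hs := fun X Y => (summable_modeSum hk p i X Y)
  refine ((((hs X 0).sub ((((hs (X + 1) 1).add (hs (X - 1) 1)).mul_left (k / 4)).mul_left
    2)).div_const (ellC k))).congr fun m => ?_
  have := coefB_harmonic_axis hk m X
  rw [eq_comm, eq_div_iff hC]
  linear_combination (2 * modeWeight k p m * (qNome k ^ m) ^ i) * this

/-- The terms of the flux through the pole. -/
def fluxTerm (k : ℝ) (N p m : ℕ) : ℝ :=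
  (1 - (qNome k ^ m) ^ 2) * (coefA k m p * coefB k m p 0) * (qNome k ^ m) ^ (2 * N)

lemma one_sub_qNome_pow_nonneg {k : ℝ} (hk : k ∈ Ioo (0 : ℝ) 1) (m : ℕ) :
    0 ≤ 1 - (qNome k ^ m) ^ 2 := by
  have := qNome_pow_mem hk m
  nlinarith [this.1, this.2]

lemma fluxTerm_nonneg {k : ℝ} (hk : k ∈ Ioo (0 : ℝ) 1) (N m : ℕ) {p : ℕ} (hp : 1 ≤ p) :
    0 ≤ fluxTerm k N p m := by
  have hp0 : (0 : ℝ) < p := by exact_mod_cast hp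
  have h : coefA k m p * coefB k m p 0 = m / p * coefB k m p 0 ^ 2 := by
    have := coefA_mul_eq hk m p
    push_cast at this
    field_simp
    linear_combination coefB k m p 0 * this
  have hq := (qNome_pow_mem hk m).1.le
  rw [fluxTerm, h]
  have := one_sub_qNome_pow_nonneg hk m
  positivity

lemma hasSum_fluxTerm {k : ℝ} (hk : k ∈ Ioo (0 : ℝ) 1) (N p : ℕ) :
    HasSum (fun m => fluxTerm k N p m) (ellC k * modeFlux k p (2 * N) p) := by
  have hC := (ellC_pos hk).ne'
  refine ((summable_modeFlux hk p (2 * N) p).hasSum.mul_left (ellC k)).congr_fun fun m => ?_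
  rw [modeWeight, fluxTerm]
  field_simp

lemma qNome_pow_two_mul_lt_one {k : ℝ} (hk : k ∈ Ioo (0 : ℝ) 1) {N : ℕ} (hN : N ≠ 0) :
    0 ≤ qNome k ^ N ∧ qNome k ^ N < 1 :=
  ⟨pow_nonneg (qNome_mem hk).1.le _, pow_lt_one₀ (qNome_mem hk).1.le (qNome_mem hk).2 hN⟩

lemma tsum_modeSum_ne_top {k : ℝ} (hk : k ∈ Ioo (0 : ℝ) 1) {N : ℕ} (hN : N ≠ 0) :
    ∑' p : ℕ, ENNReal.ofReal (modeSum k p (2 * N) p 0) ≠ ∞ := by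
  set B : ℝ := 1 / (2 * π) * ∫ θ in -π..π, (ellC k / deltaAmp k θ) ^ 2 with hB
  have hC := ellC_pos hk
  have hterm : ∀ p m : ℕ, modeWeight k p m * (qNome k ^ m) ^ (2 * N) * coefB k m p 0 =
      (1 - (qNome k ^ m) ^ 2) * (qNome k ^ m) ^ (2 * N) / ellC k * coefB k m p 0 ^ 2 := by
    intro p m
    rw [modeWeight]
    ring
  have hnn : ∀ m : ℕ, 0 ≤ (1 - (qNome k ^ m) ^ 2) * (qNome k ^ m) ^ (2 * N) / ellC k := fun m =>
    div_nonneg (mul_nonneg (one_sub_qNome_pow_nonneg hk m)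
      (pow_nonneg (qNome_pow_mem hk m).1.le _)) hC.le
  have h1 : ∀ p : ℕ, ENNReal.ofReal (modeSum k p (2 * N) p 0) =
      ∑' m : ℕ, ENNReal.ofReal ((1 - (qNome k ^ m) ^ 2) * (qNome k ^ m) ^ (2 * N) / ellC k) *
        ENNReal.ofReal (coefB k m p 0 ^ 2) := by
    intro p
    rw [modeSum, ENNReal.ofReal_tsum_of_nonneg _ (summable_modeSum hk p _ p 0)]
    · exact tsum_congr fun m => by rw [hterm, ENNReal.ofReal_mul (hnn m)]
    · intro m
      rw [hterm]
      exact mul_nonneg (hnn m) (sq_nonneg _)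
  simp only [h1]
  rw [ENNReal.tsum_comm]
  simp only [ENNReal.tsum_mul_left]
  have h2 : ∀ m : ℕ, ∑' p : ℕ, ENNReal.ofReal (coefB k m p 0 ^ 2) ≤ ENNReal.ofReal B := by
    intro m
    have h := hasSum_coefB_sq hk m
    rw [← hB] at h
    rw [← h.tsum_eq, ENNReal.ofReal_tsum_of_nonneg (fun _ => sq_nonneg _) h.summable]
    exact ENNReal.tsum_comp_le_tsum_of_injective Nat.cast_injective
      (fun p : ℤ => ENNReal.ofReal (coefB k m p 0 ^ 2))
  refine ne_top_of_le_ne_top ?_ (ENNReal.tsum_le_tsum fun m => mul_le_mul_right (h2 m) _)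
  rw [ENNReal.tsum_mul_right]
  refine ENNReal.mul_ne_top ?_ ENNReal.ofReal_ne_top
  obtain ⟨q0, q1⟩ := qNome_pow_two_mul_lt_one hk (mul_ne_zero two_ne_zero hN)
  have hs : Summable fun m : ℕ => (qNome k ^ (2 * N)) ^ m / ellC k :=
    (summable_geometric_of_lt_one q0 q1).div_const _
  refine ne_top_of_le_ne_top (ENNReal.ofReal_ne_top (r := ∑' m : ℕ, (qNome k ^ (2 * N)) ^ m / ellC k)) ?_
  rw [ENNReal.ofReal_tsum_of_nonneg (fun m => by positivity) hs]
  refine ENNReal.tsum_le_tsum fun m => ENNReal.ofReal_le_ofReal ?_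
  rw [pow_right_comm (qNome k) (2 * N) m]
  have h3 := (qNome_pow_mem hk m).1.le
  refine div_le_div_of_nonneg_right ?_ hC.le
  exact mul_le_of_le_one_left (by positivity) (by nlinarith [sq_nonneg (qNome k ^ m)])

lemma crossSum_natCast_ne_top {t : ℝ} (ht : t ∈ Ioo (0 : ℝ) (1 / 4)) {N : ℕ} (hN : N ≠ 0) (e : ℤ) :
    crossSum t N e ≠ ∞ := by
  have hk : 4 * t ∈ Ioo (0 : ℝ) 1 := ⟨by linarith [ht.1], by linarith [ht.2]⟩
  rw [crossSum_eq ht]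
  refine ne_top_of_le_ne_top (tsum_modeSum_ne_top hk hN) (ENNReal.tsum_le_tsum fun p => ?_)
  split_ifs with hp
  · refine ENNReal.ofReal_le_ofReal ?_
    have h1 := crossGreen_natCast ht N p
    have h2 := crossGreen_nonneg ht (show (1 : ℤ) ≤ p by omega) N
    have h3 := (hasSum_fluxTerm hk N p).nonneg fun m => fluxTerm_nonneg hk N m hp.1
    linarith
  · exact zero_le

lemma tsum_fluxTerm {k : ℝ} (hk : k ∈ Ioo (0 : ℝ) 1) (N : ℕ) (e : ℤ) (m : ℕ) :
    (∑' p : ℕ, if 1 ≤ p ∧ (p : ℤ) % 2 = e then ENNReal.ofReal (fluxTerm k N p m) else 0) =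
      ENNReal.ofReal (if 1 ≤ m ∧ (m : ℤ) % 2 = e then (qNome k ^ (2 * N)) ^ m else 0) := by
  rcases Nat.eq_zero_or_pos m with rfl | hm
  · simp [fluxTerm]
  have hodd : ∀ p : ℕ, (p : ℤ) % 2 ≠ (m : ℤ) % 2 → fluxTerm k N p m = 0 := by
    intro p hp
    rw [fluxTerm, coefA_eq_zero_of_odd hk (Int.odd_iff.2 (by omega))]
    ring
  split_ifs with h
  · have hs : HasSum (fun p => fluxTerm k N p m) (1 * (qNome k ^ m) ^ (2 * N)) :=
      (hasSum_nat_coefA_mul_coefB hk hm.ne').mul_right ((qNome k ^ m) ^ (2 * N))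
    have hz : ∀ p : ℕ, ¬ 1 ≤ p → fluxTerm k N p m = 0 := by
      intro p hp
      obtain rfl : p = 0 := by omega
      rw [fluxTerm, Nat.cast_zero, coefB_zero_right hk (by omega)]
      ring
    have hn : ∀ p : ℕ, 0 ≤ fluxTerm k N p m := fun p => by
      by_cases hp : 1 ≤ p
      · exact fluxTerm_nonneg hk N m hp
      · exact (hz p hp).ge
    rw [one_mul] at hs
    rw [pow_right_comm, ← hs.tsum_eq,
      ENNReal.ofReal_tsum_of_nonneg hn hs.summable]
    refine tsum_congr fun p => ?_
    split_ifs with hp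
    · rfl
    · by_cases hp1 : 1 ≤ p
      · rw [hodd p (by omega), ENNReal.ofReal_zero]
      · rw [hz p hp1, ENNReal.ofReal_zero]
  · rw [ENNReal.ofReal_zero, ENNReal.tsum_eq_zero]
    intro p
    split_ifs with hp
    · rw [hodd p (by omega), ENNReal.ofReal_zero]
    · rfl

lemma natCast_mul_loopSum {t : ℝ} (ht : t ∈ Ioo (0 : ℝ) (1 / 4)) {N : ℕ} (hN : N ≠ 0) (e : ℤ) :
    N * loopSum t N e = ∑' m : ℕ, ENNReal.ofReal
      (if 1 ≤ m ∧ (m : ℤ) % 2 = e then (qNome (4 * t) ^ (2 * N)) ^ m else 0) := by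
  have hk : 4 * t ∈ Ioo (0 : ℝ) 1 := ⟨by linarith [ht.1], by linarith [ht.2]⟩
  have h := crossSum_neg t N e
  have h2 : crossSum t (-N) e = (∑' p : ℕ, if 1 ≤ p ∧ (p : ℤ) % 2 = e then
      ∑' m, ENNReal.ofReal (fluxTerm (4 * t) N p m) else 0) + crossSum t N e := by
    rw [crossSum_eq ht, crossSum_eq ht, ← ENNReal.tsum_add]
    refine tsum_congr fun p => ?_
    split_ifs with hp
    · have hf := hasSum_fluxTerm hk N p
      have hp1 : (1 : ℤ) ≤ p := by omega
      have hn := fun m => fluxTerm_nonneg hk N m hp.1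
      rw [← ENNReal.ofReal_tsum_of_nonneg hn hf.summable, hf.tsum_eq,
        ← ENNReal.ofReal_add (hf.nonneg hn) (crossGreen_nonneg ht hp1 _),
        crossGreen_neg_natCast ht hN hp1, crossGreen_natCast ht]
      congr 1
      ring
    · rw [add_zero]
  rw [h2] at h
  rw [← (ENNReal.add_left_inj (crossSum_natCast_ne_top ht hN e)).1 h]
  simp only [← tsum_fluxTerm hk]
  rw [ENNReal.tsum_comm]
  refine tsum_congr fun p => ?_
  split_ifs <;> simp

lemma hasSum_geometric_even {r : ℝ} (h0 : 0 ≤ r) (h1 : r < 1) :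
    HasSum (fun m : ℕ => if 1 ≤ m ∧ (m : ℤ) % 2 = 0 then r ^ m else 0) (r ^ 2 / (1 - r ^ 2)) := by
  have h2 : r ^ 2 < 1 := by nlinarith
  have he := (hasSum_geometric_of_lt_one (sq_nonneg r) h2).sub (hasSum_ite_eq 0 (1 : ℝ))
  have ho : HasSum (fun _ : ℕ => (0 : ℝ)) 0 := hasSum_zero
  have h := HasSum.even_add_odd
    (f := fun m : ℕ => if 1 ≤ m ∧ (m : ℤ) % 2 = 0 then r ^ m else 0)
    (he.congr_fun fun j => ?_) (ho.congr_fun fun j => ?_)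
  · rwa [add_zero, show (1 - r ^ 2)⁻¹ - 1 = r ^ 2 / (1 - r ^ 2) by
      have : 1 - r ^ 2 ≠ 0 := by linarith
      field_simp
      ring] at h
  · rcases Nat.eq_zero_or_pos j with rfl | hj
    · simp
    · rw [if_pos ⟨by omega, by omega⟩, if_neg hj.ne', pow_mul, sub_zero]
  · rw [if_neg (by omega)]

lemma hasSum_geometric_odd {r : ℝ} (h0 : 0 ≤ r) (h1 : r < 1) :
    HasSum (fun m : ℕ => if 1 ≤ m ∧ (m : ℤ) % 2 = 1 then r ^ m else 0) (r / (1 - r ^ 2)) := by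
  have h2 : r ^ 2 < 1 := by nlinarith
  have ho := (hasSum_geometric_of_lt_one (sq_nonneg r) h2).mul_left r
  have he : HasSum (fun _ : ℕ => (0 : ℝ)) 0 := hasSum_zero
  have h := HasSum.even_add_odd
    (f := fun m : ℕ => if 1 ≤ m ∧ (m : ℤ) % 2 = 1 then r ^ m else 0)
    (he.congr_fun fun j => ?_) (ho.congr_fun fun j => ?_)
  · rwa [zero_add, ← div_eq_mul_inv] at h
  · rw [if_neg (by omega)]
  · rw [if_pos ⟨by omega, by omega⟩, pow_succ', pow_mul]

lemma loopSum_eq {t : ℝ} (ht : t ∈ Ioo (0 : ℝ) (1 / 4)) {n : ℤ} (hn : n ≠ 0) {e : ℤ} {v : ℝ}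
    (hv : HasSum (fun m : ℕ => if 1 ≤ m ∧ (m : ℤ) % 2 = e then
      (qNome (4 * t) ^ (2 * n.natAbs)) ^ m else 0) v) :
    loopSum t n e = ENNReal.ofReal (1 / (n.natAbs : ℝ) * v) := by
  have hk : 4 * t ∈ Ioo (0 : ℝ) 1 := ⟨by linarith [ht.1], by linarith [ht.2]⟩
  have hN : n.natAbs ≠ 0 := Int.natAbs_ne_zero.2 hn
  have hs : loopSum t n e = loopSum t n.natAbs e := by
    rcases Int.natAbs_eq n with h | h
    · rw [← h]
    · rw [← loopSum_neg, h, neg_neg, Int.natAbs_neg, Int.natAbs_natCast]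
  have h := natCast_mul_loopSum ht hN e
  have hq := (qNome_mem hk).1.le
  rw [← ENNReal.ofReal_tsum_of_nonneg (fun m => by split_ifs <;> positivity) hv.summable,
    hv.tsum_eq] at h
  rw [hs, ENNReal.ofReal_mul (by positivity), ← h, ← mul_assoc, one_div,
    ENNReal.ofReal_inv_of_pos (by positivity), ENNReal.ofReal_natCast,
    ENNReal.inv_mul_cancel (by exact_mod_cast hN) (by finiteness), one_mul]

lemma hasSum_loops {t : ℝ} (ht : 0 ≤ t) {n : ℤ} (hn : n ≠ 0) {e : ℤ} {P : ℤ → Prop}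
    (hP : ∀ z, P z ↔ z % 2 = e) {v : ℝ} (hv0 : 0 ≤ v)
    (hv : loopSum t n e = ENNReal.ofReal v) :
    HasSum (fun w : {w : List (ℤ × ℤ) // IsLoop n w ∧ ∀ x ∈ w, P (x.1 + x.2)} =>
      t ^ (w.val.length - 1) / ((w.val.length - 1 : ℕ) : ℝ)) v := by
  obtain rfl : P = fun z => z % 2 = e := funext fun z => propext (hP z)
  have h : ∑' w : {w : List (ℤ × ℤ) // IsLoop n w ∧ ∀ x ∈ w, (x.1 + x.2) % 2 = e},
      ENNReal.ofReal (t ^ (w.val.length - 1) / ((w.val.length - 1 : ℕ) : ℝ)) =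
      ENNReal.ofReal v := by
    rw [← hv, ← (loopEquiv hn e).tsum_eq, ENNReal.tsum_sigma', loopSum]
    refine tsum_congr fun l => ?_
    rw [setCount, ← tsum_subtype, ← ENNReal.tsum_mul_left]
    refine tsum_congr fun f => ?_
    rw [length_loopEquiv, Pi.one_apply, mul_one, ENNReal.ofReal_div_of_pos (by positivity),
      ENNReal.ofReal_pow ht, ENNReal.ofReal_natCast, Nat.cast_succ]
  have hs := ENNReal.hasSum_toReal (h.trans_ne ENNReal.ofReal_ne_top)
  rw [← ENNReal.tsum_toReal_eq fun _ => ENNReal.ofReal_ne_top, h, ENNReal.toReal_ofReal hv0] at hs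
  exact hs.congr_fun fun w => (ENNReal.toReal_ofReal (by positivity)).symm

/-- Theorem 19 (loop generating functions): for `t ∈ (0,1/4)`, `k = 4t` and `n ≠ 0`,
`Σ_{w ∈ ℒ_n^{even}} t^{|w|}/|w| = (1/|n|) q^{4|n|}/(1-q^{4|n|})` and
`Σ_{w ∈ ℒ_n^{odd}} t^{|w|}/|w| = (1/|n|) q^{2|n|}/(1-q^{4|n|})`,
both sums converging absolutely. -/
theorem statement17 (t : ℝ) (ht : t ∈ Set.Ioo (0 : ℝ) (1 / 4)) (k : ℝ) (hk : k = 4 * t)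
    (n : ℤ) (hn : n ≠ 0) :
    Summable (fun w : {w : List (ℤ × ℤ) // IsLoop n w ∧ ∀ x ∈ w, Even (x.1 + x.2)} =>
        t ^ (w.val.length - 1) / ((w.val.length - 1 : ℕ) : ℝ)) ∧
    (∑' w : {w : List (ℤ × ℤ) // IsLoop n w ∧ ∀ x ∈ w, Even (x.1 + x.2)},
        t ^ (w.val.length - 1) / ((w.val.length - 1 : ℕ) : ℝ)) =
      1 / (n.natAbs : ℝ) *
        (qNome k ^ (4 * n.natAbs) / (1 - qNome k ^ (4 * n.natAbs))) ∧
    Summable (fun w : {w : List (ℤ × ℤ) // IsLoop n w ∧ ∀ x ∈ w, Odd (x.1 + x.2)} =>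
        t ^ (w.val.length - 1) / ((w.val.length - 1 : ℕ) : ℝ)) ∧
    (∑' w : {w : List (ℤ × ℤ) // IsLoop n w ∧ ∀ x ∈ w, Odd (x.1 + x.2)},
        t ^ (w.val.length - 1) / ((w.val.length - 1 : ℕ) : ℝ)) =
      1 / (n.natAbs : ℝ) *
        (qNome k ^ (2 * n.natAbs) / (1 - qNome k ^ (4 * n.natAbs))) := by
  subst hk
  have hk : 4 * t ∈ Set.Ioo (0 : ℝ) 1 := ⟨by linarith [ht.1], by linarith [ht.2]⟩
  obtain ⟨q0, q1⟩ := qNome_pow_two_mul_lt_one hk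
    (mul_ne_zero two_ne_zero (Int.natAbs_ne_zero.2 hn))
  have h4 : qNome (4 * t) ^ (4 * n.natAbs) = (qNome (4 * t) ^ (2 * n.natAbs)) ^ 2 := by ring
  have h1 : 0 < 1 - (qNome (4 * t) ^ (2 * n.natAbs)) ^ 2 := by nlinarith
  have he := hasSum_loops ht.1.le hn (P := Even) (fun _ => Int.even_iff) (by positivity)
    (loopSum_eq ht hn (hasSum_geometric_even q0 q1))
  have ho := hasSum_loops ht.1.le hn (P := Odd) (fun _ => Int.odd_iff) (by positivity)
    (loopSum_eq ht hn (hasSum_geometric_odd q0 q1))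
  rw [h4]
  exact ⟨he.summable, he.tsum_eq, ho.summable, ho.tsum_eq⟩

end
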